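/- arXiv:1212.5431 — 2 statements merged into one kernel-verified Lean document; each statement's English description precedes it below -/
import Mathlib

section
/- Let μ and σ be Borel measures with growth of degree n in ℝ^d such that the n-dimensional Riesz transform R_μ is bounded in L²(μ) and R_σ is bounded in L²(σ).ate Then R_{μ+σ} is bounded in L²(μ+σ). -/
open MeasureTheory Metric Set Filter
open scoped ENNReal NNReal Topology

noncomputable section

abbrev Euc (d : ℕ) := EuclideanSpace ℝ (Fin d)

/-- The `ε`-truncated `n`-dimensional Riesz transform of `f μ`. -/
def truncRiesz (n : ℕ) {d : ℕ} (μ : Measure (Euc d)) (ε : ℝ) (f : Euc d → ℝ)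
    (x : Euc d) : Euc d :=
  ∫ y in {y : Euc d | ε < ‖x - y‖}, (‖x - y‖ ^ (n + 1))⁻¹ • f y • (x - y) ∂μ

/-- The `ε`-regularized `n`-dimensional Riesz transform of `f μ`, with kernel
`K_ε(x) = x / max(|x|, ε)^(n+1)`. -/
def regRiesz (n : ℕ) {d : ℕ} (μ : Measure (Euc d)) (ε : ℝ) (f : Euc d → ℝ)
    (x : Euc d) : Euc d :=
  ∫ y, ((max ‖x - y‖ ε) ^ (n + 1))⁻¹ • f y • (x - y) ∂μ

/-- `R_μ` is bounded in `L²(μ)`: the truncated operators are bounded uniformly in `ε > 0`. -/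
def RieszBounded (n : ℕ) {d : ℕ} (μ : Measure (Euc d)) : Prop :=
  ∃ C : ℝ, 0 < C ∧ ∀ ε : ℝ, 0 < ε → ∀ f : Euc d → ℝ, Measurable f →
    ∫⁻ x, (‖truncRiesz n μ ε f x‖₊ : ℝ≥0∞) ^ 2 ∂μ ≤
      ENNReal.ofReal C * ∫⁻ x, (‖f x‖₊ : ℝ≥0∞) ^ 2 ∂μ

/-- The regularized operators `R̃_{μ,ε}` are bounded in `L²(μ)` uniformly in `ε > 0`. -/
def RegRieszBounded (n : ℕ) {d : ℕ} (μ : Measure (Euc d)) : Prop :=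
  ∃ C : ℝ, 0 < C ∧ ∀ ε : ℝ, 0 < ε → ∀ f : Euc d → ℝ, Measurable f →
    ∫⁻ x, (‖regRiesz n μ ε f x‖₊ : ℝ≥0∞) ^ 2 ∂μ ≤
      ENNReal.ofReal C * ∫⁻ x, (‖f x‖₊ : ℝ≥0∞) ^ 2 ∂μ

/-- `μ` has growth of degree `n` with constant `c`. -/
def GrowthDeg (n : ℕ) {d : ℕ} (μ : Measure (Euc d)) (c : ℝ) : Prop :=
  ∀ (x : Euc d) (r : ℝ), 0 < r → μ (closedBall x r) ≤ ENNReal.ofReal (c * r ^ n)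

/-- A set is `n`-rectifiable: up to an `H^n`-null set it is contained in a countable union of
Lipschitz images of `ℝ^n`. -/
def IsRectifiable (n : ℕ) {d : ℕ} (E : Set (Euc d)) : Prop :=
  ∃ (f : ℕ → EuclideanSpace ℝ (Fin n) → Euc d) (K : ℕ → ℝ≥0),
    (∀ i, LipschitzWith (K i) (f i)) ∧ μH[(n : ℝ)] (E \ ⋃ i, Set.range (f i)) = 0

/-- Every `n`-rectifiable subset has `H^n` measure zero. -/
def PurelyUnrectifiable (n : ℕ) {d : ℕ} (E : Set (Euc d)) : Prop :=
  ∀ F, F ⊆ E → IsRectifiable n F → μH[(n : ℝ)] F = 0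

/-- The support of a measure. -/
def measureSupport {d : ℕ} (μ : Measure (Euc d)) : Set (Euc d) :=
  {x | ∀ r : ℝ, 0 < r → 0 < μ (ball x r)}

/-- The lower `n`-dimensional density `θⁿ_*(x, μ)`. -/
def lowerDensity (n : ℕ) {d : ℕ} (μ : Measure (Euc d)) (x : Euc d) : ℝ≥0∞ :=
  Filter.liminf (fun r : ℝ => μ (closedBall x r) / ENNReal.ofReal (r ^ n)) (𝓝[>] (0 : ℝ))

/-- `μ` is Ahlfors–David regular of dimension `n`. -/
def ADRegular (n : ℕ) {d : ℕ} (μ : Measure (Euc d)) : Prop :=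
  ∃ c : ℝ, 1 ≤ c ∧ ∀ x ∈ measureSupport μ, ∀ r : ℝ, 0 < r →
    ENNReal.ofReal r ≤ EMetric.diam (measureSupport μ) →
    ENNReal.ofReal (c⁻¹ * r ^ n) ≤ μ (closedBall x r) ∧
      μ (closedBall x r) ≤ ENNReal.ofReal (c * r ^ n)

/-- An `n`-dimensional affine plane in `ℝ^d`. -/
def IsAffineNPlane (n : ℕ) {d : ℕ} (W : Set (Euc d)) : Prop :=
  ∃ (a : Euc d) (V : Submodule ℝ (Euc d)), Module.finrank ℝ V = n ∧
    W = (fun v => a + v) '' (V : Set (Euc d))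

/-- The centered Hardy–Littlewood maximal operator with respect to `μ`. -/
def maximalOp {d : ℕ} (μ : Measure (Euc d)) (f : Euc d → ℝ) (x : Euc d) : ℝ≥0∞ :=
  ⨆ (r : ℝ) (_ : 0 < r),
    (μ (closedBall x r))⁻¹ * ∫⁻ y in closedBall x r, (‖f y‖₊ : ℝ≥0∞) ∂μ

/-- Harmonicity on a set, expressed through continuity together with the mean value property
over closed balls. -/
def MeanValueHarmonicOn {d : ℕ} (f : Euc d → ℝ) (U : Set (Euc d)) : Prop :=
  ContinuousOn f U ∧ ∀ x ∈ U, ∀ r : ℝ, 0 < r → closedBall x r ⊆ U →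
    f x = ⨍ y in closedBall x r, f y ∂volume

/-- `E` is removable for Lipschitz harmonic functions. -/
def RemovableForLipschitzHarmonic {d : ℕ} (E : Set (Euc d)) : Prop :=
  ∀ Ω : Set (Euc d), IsOpen Ω → ∀ f : Euc d → ℝ,
    (∃ K : ℝ≥0, LipschitzOnWith K f Ω) →
    MeanValueHarmonicOn f (Ω \ E) → MeanValueHarmonicOn f Ω

/-- The distance between two sets. -/
def ballsDist {d : ℕ} (A B : Set (Euc d)) : ℝ :=
  sInf (Set.image2 dist A B)

end

noncomputable section

/-- Odd kernels of Calderón–Zygmund type and dimension `n`, regularized at scale `ε`. -/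
structure OddCZKernel {E : Type*} [NormedAddCommGroup E] (n : ℕ) (ε L : ℝ) (k : E → ℝ) : Prop where
  continuous : Continuous k
  odd : ∀ z, k (-z) = -k z
  size : ∀ z, |k z| ≤ ((max ‖z‖ ε) ^ n)⁻¹
  smooth : ∀ z w, ‖z - w‖ ≤ ‖z‖ / 2 → |k z - k w| ≤ L * ‖z - w‖ * (‖z‖ ^ (n + 1))⁻¹

/-- The integral operator with convolution kernel `k` with respect to the measure `μ`. -/
def kernelOp {E : Type*} [NormedAddCommGroup E] [MeasurableSpace E] (k : E → ℝ) (μ : Measure E)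
    (f : E → ℝ) (x : E) : ℝ :=
  ∫ y, k (x - y) * f y ∂μ

lemma integrable_of_abs_le {α : Type*} [MeasurableSpace α] {μ : Measure α} [IsFiniteMeasure μ]
    {f : α → ℝ} (hf : Measurable f) {C : ℝ} (hC : ∀ x, |f x| ≤ C) : Integrable f μ :=
  Integrable.of_bound hf.aestronglyMeasurable C (ae_of_all _ hC)

lemma integrableOn_of_abs_le {α : Type*} [MeasurableSpace α] {μ : Measure α} [IsFiniteMeasure μ]
    {f : α → ℝ} (hf : Measurable f) {s : Set α} (hs : MeasurableSet s) {C : ℝ}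
    (hC : ∀ x ∈ s, |f x| ≤ C) : IntegrableOn f s μ :=
  Measure.integrableOn_of_bounded (measure_ne_top _ _) hf.aestronglyMeasurable
    ((ae_restrict_iff' hs).2 (ae_of_all _ hC))

lemma setIntegral_le_of_le_const {α : Type*} [MeasurableSpace α] {μ : Measure α}
    [IsFiniteMeasure μ] {f : α → ℝ} {s : Set α} {C : ℝ} (h0 : ∀ x ∈ s, 0 ≤ f x)
    (hC : ∀ x ∈ s, f x ≤ C) :
    ∫ x in s, f x ∂μ ≤ C * μ.real s := by
  have h : ∀ x ∈ s, ‖f x‖ ≤ C := fun x hx => by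
    rw [Real.norm_of_nonneg (h0 x hx)]; exact hC x hx
  exact (le_abs_self _).trans (norm_setIntegral_le_of_norm_le_const (measure_lt_top _ _) h)

/-- Around every point there is a first doubling ball among the dilates by powers of `50`. -/
lemma exists_first_doubling {X : Type*} [PseudoMetricSpace X] [MeasurableSpace X]
    {μ : Measure X} [IsFiniteMeasure μ] (hμ0 : 0 < μ.real univ) (x : X) {s D : ℝ}
    (hs : 0 < s) (hD : 2 ≤ D) :
    ∃ k : ℕ, (∀ j < k, D * μ.real (closedBall x (50 ^ j * s)) ≤
        μ.real (closedBall x (50 ^ (j + 1) * s))) ∧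
      0 < μ.real (closedBall x (50 ^ k * s)) ∧
      μ.real (closedBall x (50 ^ (k + 1) * s)) ≤ D * μ.real (closedBall x (50 ^ k * s)) := by
  classical
  set a : ℕ → ℝ := fun j => μ.real (closedBall x (50 ^ j * s))
  have ha0 : ∀ j, 0 ≤ a j := fun j => measureReal_nonneg
  have hlim : Tendsto a atTop (𝓝 (μ.real univ)) := by
    have hmono : Monotone fun j : ℕ => closedBall x ((50 : ℝ) ^ j * s) := fun i j hij =>
      closedBall_subset_closedBall (by gcongr; norm_num)
    have hU : ⋃ j : ℕ, closedBall x ((50 : ℝ) ^ j * s) = univ := by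
      refine eq_univ_of_forall fun y => mem_iUnion.2 ?_
      obtain ⟨j, hj⟩ := pow_unbounded_of_one_lt (dist y x / s) (by norm_num : (1 : ℝ) < 50)
      exact ⟨j, mem_closedBall.2 ((div_lt_iff₀ hs).1 hj).le⟩
    have := tendsto_measure_iUnion_atTop (μ := μ) hmono
    rw [hU] at this
    exact (ENNReal.tendsto_toReal (measure_ne_top _ _)).comp this
  have hex : ∃ k, 0 < a k ∧ a (k + 1) ≤ D * a k := by
    by_contra! hcon
    have h1 : ∀ k, D * a k ≤ a (k + 1) := fun k => by
      rcases (ha0 k).eq_or_lt with h | h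
      · rw [← h, mul_zero]; exact ha0 _
      · exact (hcon k h).le
    have h2 := le_of_tendsto_of_tendsto' (hlim.const_mul D)
      (hlim.comp (tendsto_add_atTop_nat 1)) h1
    nlinarith
  refine ⟨Nat.find hex, fun j hj => ?_, Nat.find_spec hex⟩
  have := Nat.find_min hex hj
  rcases (ha0 j).eq_or_lt with h | h
  · change D * a j ≤ a (j + 1)
    rw [← h, mul_zero]; exact ha0 _
  · by_contra hlt
    exact this ⟨h, (not_le.1 hlt).le⟩

section Kernel

variable {E : Type*} [NormedAddCommGroup E] {n : ℕ} {ε L c A : ℝ} {k : E → ℝ}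

namespace OddCZKernel

lemma abs_le (hk : OddCZKernel n ε L k) (hε : 0 < ε) (z : E) : |k z| ≤ (ε ^ n)⁻¹ :=
  (hk.size z).trans (by gcongr; exact le_max_right _ _)

lemma abs_le_of_lt (hk : OddCZKernel n ε L k) {z : E} {r : ℝ} (hr : 0 < r) (h : r ≤ ‖z‖) :
    |k z| ≤ (r ^ n)⁻¹ :=
  (hk.size z).trans (by gcongr; exact h.trans (le_max_left _ _))

variable [MeasurableSpace E] [BorelSpace E] [SecondCountableTopology E] {μ : Measure E}

lemma measurable_sub (hk : OddCZKernel n ε L k) (x : E) : Measurable fun y => k (x - y) :=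
  hk.continuous.measurable.comp (measurable_const.sub measurable_id)

lemma integrable_mul (hk : OddCZKernel n ε L k) (hε : 0 < ε) {f : E → ℝ} (hf : Integrable f μ)
    (x : E) : Integrable (fun y => k (x - y) * f y) μ :=
  hf.bdd_mul (hk.measurable_sub x).aestronglyMeasurable
    (ae_of_all _ fun y => hk.abs_le hε (x - y))

end OddCZKernel

variable [MeasurableSpace E] [BorelSpace E] {μ : Measure E}

/-- A measure of growth `n` integrates `|x - y|^{-n-1}` away from a ball. -/
lemma setIntegral_compl_closedBall_le [IsFiniteMeasure μ] (hc : 0 ≤ c)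
    (hμ : ∀ (x : E) (r : ℝ), 0 < r → μ.real (closedBall x r) ≤ c * r ^ n) (x : E) {R : ℝ}
    (hR : 0 < R) :
    ∫ y in (closedBall x R)ᶜ, (‖x - y‖ ^ (n + 1))⁻¹ ∂μ ≤ c * 2 ^ (n + 1) / R := by
  have hmeas : Measurable fun y : E => (‖x - y‖ ^ (n + 1))⁻¹ := by fun_prop
  have hbd : ∀ {R : ℝ}, 0 < R → ∀ y ∈ (closedBall x R)ᶜ,
      (‖x - y‖ ^ (n + 1))⁻¹ ≤ (R ^ (n + 1))⁻¹ := by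
    intro R hR y hy
    have : R < ‖x - y‖ := by simpa [dist_eq_norm, norm_sub_rev] using hy
    gcongr
  have hint : ∀ {R : ℝ}, 0 < R → IntegrableOn (fun y : E => (‖x - y‖ ^ (n + 1))⁻¹)
      (closedBall x R)ᶜ μ := fun {R} hR =>
    integrableOn_of_abs_le hmeas measurableSet_closedBall.compl (C := (R ^ (n + 1))⁻¹)
      fun y hy => by rw [abs_of_nonneg (by positivity)]; exact hbd hR y hy
  have key : ∀ (M : ℕ) (R : ℝ), 0 < R →
      ∫ y in (closedBall x R)ᶜ, (‖x - y‖ ^ (n + 1))⁻¹ ∂μ ≤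
        c * 2 ^ (n + 1) / R + μ.real univ * (R ^ (n + 1))⁻¹ * (1 / 2) ^ M := by
    intro M
    induction M with
    | zero =>
      intro R hR
      have h1 := setIntegral_le_of_le_const (μ := μ)
        (s := (closedBall x R)ᶜ) (fun y _ => by positivity) (hbd hR)
      have h2 : μ.real (closedBall x R)ᶜ ≤ μ.real univ := measureReal_mono (subset_univ _)
      have h3 : 0 ≤ c * 2 ^ (n + 1) / R := by positivity
      have h4 : (R ^ (n + 1))⁻¹ * μ.real (closedBall x R)ᶜ ≤ (R ^ (n + 1))⁻¹ * μ.real univ := by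
        gcongr
      linarith
    | succ M ih =>
      intro R hR
      have hsub : closedBall x R ⊆ closedBall x (2 * R) :=
        closedBall_subset_closedBall (by linarith)
      have hunion : (closedBall x R)ᶜ =
          (closedBall x (2 * R) \ closedBall x R) ∪ (closedBall x (2 * R))ᶜ := by
        ext y
        have := @hsub y
        simp only [mem_union, Set.mem_sdiff, mem_compl_iff]
        tauto
      have hdisj : Disjoint (closedBall x (2 * R) \ closedBall x R) (closedBall x (2 * R))ᶜ :=
        disjoint_compl_right.mono_left sdiff_subset
      rw [hunion, setIntegral_union hdisj measurableSet_closedBall.compl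
        ((hint hR).mono_set fun y hy => hy.2) (hint (by linarith))]
      have h1 : ∫ y in closedBall x (2 * R) \ closedBall x R, (‖x - y‖ ^ (n + 1))⁻¹ ∂μ ≤
          (R ^ (n + 1))⁻¹ * μ.real (closedBall x (2 * R) \ closedBall x R) :=
        setIntegral_le_of_le_const (fun y _ => by positivity) fun y hy => hbd hR y hy.2
      have h2 : μ.real (closedBall x (2 * R) \ closedBall x R) ≤ c * (2 * R) ^ n :=
        (measureReal_mono sdiff_subset).trans (hμ x _ (by linarith))
      have h3 := ih (2 * R) (by linarith)
      have h4 : (R ^ (n + 1))⁻¹ * μ.real (closedBall x (2 * R) \ closedBall x R) ≤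
          c * 2 ^ n / R := by
        calc _ ≤ (R ^ (n + 1))⁻¹ * (c * (2 * R) ^ n) := by gcongr
          _ = _ := by rw [mul_pow]; field_simp; ring
      have h5 : c * 2 ^ (n + 1) / (2 * R) = c * 2 ^ n / R := by field_simp; ring
      have h6 : c * 2 ^ (n + 1) / R = c * 2 ^ n / R + c * 2 ^ n / R := by field_simp; ring
      have h7 : μ.real univ * ((2 * R) ^ (n + 1))⁻¹ * (1 / 2) ^ M ≤
          μ.real univ * (R ^ (n + 1))⁻¹ * (1 / 2) ^ (M + 1) := by
        have : ((2 * R) ^ (n + 1))⁻¹ ≤ (R ^ (n + 1))⁻¹ * (1 / 2) := by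
          rw [mul_pow, mul_inv, mul_comm]
          gcongr
          rw [pow_succ, mul_inv, one_div]
          exact mul_le_of_le_one_left (by positivity)
            (inv_le_one_of_one_le₀ (one_le_pow₀ (by norm_num)))
        calc _ ≤ μ.real univ * ((R ^ (n + 1))⁻¹ * (1 / 2)) * (1 / 2) ^ M := by gcongr
          _ = _ := by ring
      linarith
  have hlim : Tendsto (fun M : ℕ => c * 2 ^ (n + 1) / R +
      μ.real univ * (R ^ (n + 1))⁻¹ * (1 / 2 : ℝ) ^ M) atTop
      (𝓝 (c * 2 ^ (n + 1) / R + μ.real univ * (R ^ (n + 1))⁻¹ * 0)) :=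
    ((tendsto_pow_atTop_nhds_zero_of_lt_one (by norm_num) (by norm_num)).const_mul _).const_add _
  rw [mul_zero, add_zero] at hlim
  exact ge_of_tendsto' hlim fun M => key M R hR

variable [SecondCountableTopology E]

/-- The kernel is integrable over the dilates of a ball up to the first doubling one. -/
lemma setIntegral_abs_kernel_le [IsFiniteMeasure μ] (hk : OddCZKernel n ε L k) (hε : 0 < ε)
    (hμ : ∀ (x : E) (r : ℝ), 0 < r → μ.real (closedBall x r) ≤ c * r ^ n)
    (x : E) {s : ℝ} (hs : 0 < s) (m : ℕ)
    (hm : ∀ j < m, 2 * 50 ^ n * μ.real (closedBall x (50 ^ j * s)) ≤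
      μ.real (closedBall x (50 ^ (j + 1) * s))) :
    ∫ y in closedBall x (50 ^ (m + 1) * s) \ closedBall x s, |k (x - y)| ∂μ ≤ 3 * 50 ^ n * c := by
  have hmeas : Measurable fun y : E => |k (x - y)| := (hk.measurable_sub x).abs
  have hint : ∀ S, IntegrableOn (fun y : E => |k (x - y)|) S μ := fun S =>
    (integrable_of_abs_le hmeas (C := (ε ^ n)⁻¹) fun y => by
      rw [abs_abs]; exact hk.abs_le hε _).integrableOn
  have hstep : ∀ j : ℕ,
      ∫ y in closedBall x (50 ^ (j + 1) * s) \ closedBall x s, |k (x - y)| ∂μ ≤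
      (∫ y in closedBall x (50 ^ j * s) \ closedBall x s, |k (x - y)| ∂μ) +
        ((50 ^ j * s) ^ n)⁻¹ * μ.real (closedBall x (50 ^ (j + 1) * s)) := by
    intro j
    have hsub : closedBall x (50 ^ j * s) ⊆ closedBall x (50 ^ (j + 1) * s) :=
      closedBall_subset_closedBall (by gcongr <;> norm_num)
    have hsub' : closedBall x s ⊆ closedBall x (50 ^ j * s) :=
      closedBall_subset_closedBall (le_mul_of_one_le_left hs.le (one_le_pow₀ (by norm_num)))
    have hunion : closedBall x (50 ^ (j + 1) * s) \ closedBall x s =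
        (closedBall x (50 ^ j * s) \ closedBall x s) ∪
          (closedBall x (50 ^ (j + 1) * s) \ closedBall x (50 ^ j * s)) := by
      ext y
      have := @hsub y
      have := @hsub' y
      simp only [mem_union, Set.mem_sdiff]
      tauto
    rw [hunion, setIntegral_union (disjoint_sdiff_right.mono_left sdiff_subset)
      (measurableSet_closedBall.diff measurableSet_closedBall) (hint _) (hint _)]
    gcongr
    refine (setIntegral_le_of_le_const (C := ((50 ^ j * s) ^ n)⁻¹)
      (fun y _ => abs_nonneg _) fun y hy => ?_).trans ?_
    · refine hk.abs_le_of_lt (by positivity) ?_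
      have : 50 ^ j * s < ‖x - y‖ := by simpa [dist_eq_norm, norm_sub_rev] using hy.2
      exact this.le
    · gcongr
      · exact measure_ne_top _ _
      · exact sdiff_subset
  have key : ∀ j ≤ m, ∫ y in closedBall x (50 ^ j * s) \ closedBall x s, |k (x - y)| ∂μ ≤
      2 * 50 ^ n * ((50 ^ j * s) ^ n)⁻¹ * μ.real (closedBall x (50 ^ j * s)) := by
    intro j
    induction j with
    | zero =>
      intro _
      simp only [pow_zero, one_mul, Set.sdiff_self, Measure.restrict_empty,
        integral_zero_measure]
      positivity
    | succ j ih =>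
      intro hj
      have h1 := hstep j
      have h2 := ih (by omega)
      have h3 := hm j (by omega)
      have h4 : 2 * 50 ^ n * ((50 ^ j * s) ^ n)⁻¹ * μ.real (closedBall x (50 ^ j * s)) ≤
          ((50 ^ j * s) ^ n)⁻¹ * μ.real (closedBall x (50 ^ (j + 1) * s)) := by
        calc _ = ((50 ^ j * s) ^ n)⁻¹ * (2 * 50 ^ n * μ.real (closedBall x (50 ^ j * s))) := by ring
          _ ≤ _ := by gcongr
      have h5 : 2 * 50 ^ n * ((50 ^ (j + 1) * s) ^ n)⁻¹ = 2 * ((50 ^ j * s) ^ n)⁻¹ := by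
        rw [pow_succ, mul_pow, mul_pow, mul_pow]; field_simp
      rw [h5]
      linarith
  have h1 := hstep m
  have h2 := key m le_rfl
  have h3 := hμ x (50 ^ m * s) (by positivity)
  have h4 := hμ x (50 ^ (m + 1) * s) (by positivity)
  have h5 : 2 * 50 ^ n * ((50 ^ m * s) ^ n)⁻¹ * μ.real (closedBall x (50 ^ m * s)) ≤
      2 * 50 ^ n * c := by
    calc _ ≤ 2 * 50 ^ n * ((50 ^ m * s) ^ n)⁻¹ * (c * (50 ^ m * s) ^ n) := by gcongr
      _ = _ := by field_simp
  have h6 : ((50 ^ m * s) ^ n)⁻¹ * μ.real (closedBall x (50 ^ (m + 1) * s)) ≤ 50 ^ n * c := by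
    calc _ ≤ ((50 ^ m * s) ^ n)⁻¹ * (c * (50 ^ (m + 1) * s) ^ n) := by gcongr
      _ = _ := by rw [pow_succ, mul_pow, mul_pow, mul_pow]; field_simp
  linarith

end Kernel

section Operator
variable {E : Type*} [NormedAddCommGroup E] {n : ℕ} {ε L c A : ℝ} {k : E → ℝ}
variable [MeasurableSpace E] [BorelSpace E] [SecondCountableTopology E] {μ : Measure E}

lemma OddCZKernel.measurable_kernelOp [SFinite μ] (hk : OddCZKernel n ε L k) {f : E → ℝ}
    (hf : Measurable f) : Measurable (kernelOp k μ f) := by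
  have : StronglyMeasurable (Function.uncurry fun x y : E => k (x - y) * f y) :=
    ((hk.continuous.measurable.comp (measurable_fst.sub measurable_snd)).mul
      (hf.comp measurable_snd)).stronglyMeasurable
  exact this.integral_prod_right.measurable

lemma OddCZKernel.abs_kernelOp_le [IsFiniteMeasure μ] (hk : OddCZKernel n ε L k) (hε : 0 < ε)
    {f : E → ℝ} (hf : Integrable f μ) (x : E) :
    |kernelOp k μ f x| ≤ (ε ^ n)⁻¹ * ∫ y, |f y| ∂μ := by
  rw [← integral_const_mul]
  refine (abs_integral_le_integral_abs).trans (integral_mono (hk.integrable_mul hε hf x).abs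
    (hf.abs.const_mul _) fun y => ?_)
  simp only [abs_mul]
  gcongr
  exact hk.abs_le hε _

lemma OddCZKernel.kernelOp_add [IsFiniteMeasure μ] (hk : OddCZKernel n ε L k) (hε : 0 < ε)
    {f g : E → ℝ} (hf : Integrable f μ) (hg : Integrable g μ) (x : E) :
    kernelOp k μ (fun y => f y + g y) x = kernelOp k μ f x + kernelOp k μ g x := by
  simp only [kernelOp, mul_add]
  exact integral_add (hk.integrable_mul hε hf x) (hk.integrable_mul hε hg x)

/-- If `h` vanishes near `x` down to the scale `s`, then the value of `kernelOp k μ h` at `x` is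
controlled by the mean of `kernelOp k μ h` over some doubling ball of radius at least `s`. -/
lemma exists_doubling_kernelOp_le [IsFiniteMeasure μ] (hk : OddCZKernel n ε L k) (hε : 0 < ε)
    (hL : 0 ≤ L) (hc : 0 ≤ c) (hA : 0 ≤ A)
    (hμ : ∀ (x : E) (r : ℝ), 0 < r → μ.real (closedBall x r) ≤ c * r ^ n)
    (hT : ∀ u : E → ℝ, Measurable u → (∀ y, |u y| ≤ 1) →
      ∫ x, kernelOp k μ u x ^ 2 ∂μ ≤ A * ∫ x, u x ^ 2 ∂μ)
    (hμ0 : 0 < μ.real univ) {h : E → ℝ} (hh : Measurable h) (hh1 : ∀ y, |h y| ≤ 1)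
    {x : E} {s : ℝ} (hs : 0 < s) (hxs : s = ε ∨ ∀ y ∈ closedBall x s, h y = 0) :
    ∃ ρ, s ≤ ρ ∧ 0 < μ.real (closedBall x ρ) ∧
      μ.real (closedBall x (50 * ρ)) ≤ 2 * 50 ^ n * μ.real (closedBall x ρ) ∧
      μ.real (closedBall x ρ) * |kernelOp k μ h x| ≤
        (c + 3 * 50 ^ n * c + L * c * 2 ^ (n + 1) + (1 + A * (2 * 50 ^ n))) *
          μ.real (closedBall x ρ) + ∫ y in closedBall x ρ, |kernelOp k μ h y| ∂μ := by
  have hD : (2 : ℝ) ≤ 2 * 50 ^ n := by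
    have : (1 : ℝ) ≤ 50 ^ n := one_le_pow₀ (by norm_num)
    linarith
  obtain ⟨m, hm, hpos, hdoub⟩ := exists_first_doubling hμ0 x hs hD
  set ρ := 50 ^ m * s with hρ
  have hρ50 : 50 ^ (m + 1) * s = 50 * ρ := by rw [hρ]; ring
  have hρpos : 0 < ρ := by positivity
  have hsρ : s ≤ ρ := le_mul_of_one_le_left hs.le (one_le_pow₀ (by norm_num))
  have hchain := setIntegral_abs_kernel_le hk hε hμ x hs m hm
  rw [hρ50] at hdoub hchain
  refine ⟨ρ, hsρ, hpos, hdoub, ?_⟩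
  set B := closedBall x ρ with hB
  set B' := closedBall x (50 * ρ) with hB'
  have hBm : MeasurableSet B := measurableSet_closedBall
  have hB'm : MeasurableSet B' := measurableSet_closedBall
  set h₁ : E → ℝ := B'.indicator h with hh₁
  set h₂ : E → ℝ := B'ᶜ.indicator h with hh₂
  have hm₁ : Measurable h₁ := hh.indicator hB'm
  have hm₂ : Measurable h₂ := hh.indicator hB'm.compl
  have hb₁ : ∀ y, |h₁ y| ≤ 1 := fun y => by
    by_cases hy : y ∈ B' <;> simp [hh₁, hy, hh1]
  have hb₂ : ∀ y, |h₂ y| ≤ 1 := fun y => by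
    by_cases hy : y ∈ B' <;> simp [hh₂, hy, hh1]
  have hi : Integrable h μ := integrable_of_abs_le hh hh1
  have hi₁ : Integrable h₁ μ := integrable_of_abs_le hm₁ hb₁
  have hi₂ : Integrable h₂ μ := integrable_of_abs_le hm₂ hb₂
  have hsplit : ∀ y, kernelOp k μ h y = kernelOp k μ h₁ y + kernelOp k μ h₂ y := fun y => by
    rw [← hk.kernelOp_add hε hi₁ hi₂]
    congr 1
    ext z
    exact (congrFun (indicator_self_add_compl B' h) z).symm
  have hkm : Measurable fun y : E => |k (x - y)| := (hk.measurable_sub x).abs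
  have hkint : ∀ S, IntegrableOn (fun y : E => |k (x - y)|) S μ := fun S =>
    (integrable_of_abs_le hkm (C := (ε ^ n)⁻¹) fun y => by
      rw [abs_abs]; exact hk.abs_le hε _).integrableOn
  -- the contribution of the dilated ball at the centre
  have hnear : |kernelOp k μ h₁ x| ≤ c + 3 * 50 ^ n * c := by
    have hss : closedBall x s ⊆ B' := closedBall_subset_closedBall (by linarith)
    have e1 : |kernelOp k μ h₁ x| ≤ ∫ y in B', |k (x - y)| * |h y| ∂μ := by
      rw [← integral_indicator hB'm]
      refine abs_integral_le_integral_abs.trans (le_of_eq (integral_congr_ae (ae_of_all _ ?_)))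
      intro y
      by_cases hy : y ∈ B' <;> simp [hh₁, hy, abs_mul]
    have hfin : ∀ S, IntegrableOn (fun y : E => |k (x - y)| * |h y|) S μ := fun S =>
      (integrable_of_abs_le (hkm.mul hh.abs) (C := (ε ^ n)⁻¹) fun y => by
        simp only [Pi.mul_apply, abs_mul, abs_abs]
        calc _ ≤ (ε ^ n)⁻¹ * 1 := by gcongr; exacts [hk.abs_le hε _, hh1 y]
          _ = _ := mul_one _).integrableOn
    have e2 : ∫ y in B', |k (x - y)| * |h y| ∂μ =
        ∫ y in closedBall x s, |k (x - y)| * |h y| ∂μ +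
          ∫ y in B' \ closedBall x s, |k (x - y)| * |h y| ∂μ := by
      rw [← setIntegral_union disjoint_sdiff_right (hB'm.diff measurableSet_closedBall)
        (hfin _) (hfin _), union_sdiff_cancel hss]
    have e3 : ∫ y in B' \ closedBall x s, |k (x - y)| * |h y| ∂μ ≤ 3 * 50 ^ n * c :=
      (setIntegral_mono (hfin _) (hkint _) fun y =>
        mul_le_of_le_one_right (abs_nonneg _) (hh1 y)).trans hchain
    have e4 : ∫ y in closedBall x s, |k (x - y)| * |h y| ∂μ ≤ c := by
      rcases hxs with rfl | h0
      · calc _ ≤ (s ^ n)⁻¹ * μ.real (closedBall x s) :=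
              setIntegral_le_of_le_const (fun y _ => by positivity) fun y _ =>
                (mul_le_of_le_one_right (abs_nonneg _) (hh1 y)).trans (hk.abs_le hε _)
          _ ≤ (s ^ n)⁻¹ * (c * s ^ n) := by gcongr; exact hμ x s hs
          _ = c := by field_simp
      · rw [setIntegral_congr_fun (g := fun _ => (0 : ℝ)) measurableSet_closedBall
          fun y hy => by simp [h0 y hy]]
        simpa using hc
    linarith
  -- the oscillation of the far part
  have hfar : ∀ y ∈ B, |kernelOp k μ h₂ x - kernelOp k μ h₂ y| ≤ L * c * 2 ^ (n + 1) := by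
    intro y hy
    have hxy : ‖x - y‖ ≤ ρ := by rw [← dist_eq_norm']; exact hy
    rw [kernelOp, kernelOp,
      ← integral_sub (hk.integrable_mul hε hi₂ x) (hk.integrable_mul hε hi₂ y)]
    have hpt : ∀ z ∈ B'ᶜ, |k (x - z) - k (y - z)| ≤ L * ρ * (‖x - z‖ ^ (n + 1))⁻¹ := by
      intro z hz
      have hz' : 50 * ρ < ‖x - z‖ := by
        simpa [hB', dist_eq_norm, norm_sub_rev] using hz
      have := hk.smooth (x - z) (y - z) (by rw [sub_sub_sub_cancel_right]; linarith)
      rw [sub_sub_sub_cancel_right] at this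
      refine this.trans ?_
      gcongr
    have htail := setIntegral_compl_closedBall_le hc hμ x (R := 50 * ρ) (by positivity)
    have hint : IntegrableOn (fun z => (‖x - z‖ ^ (n + 1))⁻¹) B'ᶜ μ :=
      integrableOn_of_abs_le (by fun_prop) hB'm.compl (C := ((50 * ρ) ^ (n + 1))⁻¹) fun z hz => by
        have hz' : 50 * ρ < ‖x - z‖ := by
          simpa [hB', dist_eq_norm, norm_sub_rev] using hz
        rw [abs_of_nonneg (by positivity)]
        gcongr
    calc |∫ z, k (x - z) * h₂ z - k (y - z) * h₂ z ∂μ|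
        ≤ ∫ z, |k (x - z) * h₂ z - k (y - z) * h₂ z| ∂μ := abs_integral_le_integral_abs
      _ ≤ ∫ z, B'ᶜ.indicator (fun z => L * ρ * (‖x - z‖ ^ (n + 1))⁻¹) z ∂μ := by
          refine integral_mono
            ((hk.integrable_mul hε hi₂ x).sub (hk.integrable_mul hε hi₂ y)).abs
            ((integrable_indicator_iff hB'm.compl).2 (hint.const_mul _)) fun z => ?_
          by_cases hz : z ∈ B'ᶜ
          · simp only [indicator_of_mem hz, ← sub_mul, abs_mul]
            exact (mul_le_of_le_one_right (abs_nonneg _) (hb₂ z)).trans (hpt z hz)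
          · simp only [indicator_of_notMem hz, hh₂]
            simp
      _ = L * ρ * ∫ z in B'ᶜ, (‖x - z‖ ^ (n + 1))⁻¹ ∂μ := by
          rw [integral_indicator hB'm.compl, integral_const_mul]
      _ ≤ L * ρ * (c * 2 ^ (n + 1) / (50 * ρ)) := by gcongr
      _ = L * c * 2 ^ (n + 1) / 50 := by field_simp
      _ ≤ L * c * 2 ^ (n + 1) := div_le_self (by positivity) (by norm_num)
  set C₁ := c + 3 * 50 ^ n * c + L * c * 2 ^ (n + 1) with hC₁
  have hpt : ∀ y ∈ B, |kernelOp k μ h x| ≤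
      (C₁ + 1) + kernelOp k μ h₁ y ^ 2 + |kernelOp k μ h y| := by
    intro y hy
    have h1 := abs_le.1 hnear
    have h2 := abs_le.1 (hfar y hy)
    have h3 := hsplit x
    have h4 := hsplit y
    have h5 := neg_abs_le (kernelOp k μ h y)
    have h6 := le_abs_self (kernelOp k μ h y)
    rw [abs_le]
    constructor <;>
      nlinarith [sq_nonneg (kernelOp k μ h₁ y - 1), sq_nonneg (kernelOp k μ h₁ y + 1)]
  have hsq : Integrable (fun y => kernelOp k μ h₁ y ^ 2) μ :=
    integrable_of_abs_le ((hk.measurable_kernelOp hm₁).pow_const 2) fun y => by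
      rw [abs_pow]
      exact pow_le_pow_left₀ (abs_nonneg _) (hk.abs_kernelOp_le hε hi₁ y) 2
  have habs : Integrable (fun y => |kernelOp k μ h y|) μ :=
    integrable_of_abs_le (hk.measurable_kernelOp hh).abs fun y => by
      rw [abs_abs]
      exact hk.abs_kernelOp_le hε hi y
  have hI : ∫ _ in B, |kernelOp k μ h x| ∂μ ≤
      ∫ y in B, (C₁ + 1) + kernelOp k μ h₁ y ^ 2 + |kernelOp k μ h y| ∂μ :=
    setIntegral_mono_on (integrable_const _).integrableOn
      (((integrable_const _).add hsq).add habs).integrableOn hBm hpt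
  have hcsq : Integrable (fun y => C₁ + 1 + kernelOp k μ h₁ y ^ 2) μ :=
    (integrable_const _).add hsq
  rw [integral_add hcsq.integrableOn habs.integrableOn,
    integral_add (integrable_const _) hsq.integrableOn,
    setIntegral_const, setIntegral_const, smul_eq_mul, smul_eq_mul] at hI
  have hl2 : ∫ y in B, kernelOp k μ h₁ y ^ 2 ∂μ ≤ A * (2 * 50 ^ n) * μ.real B := by
    calc ∫ y in B, kernelOp k μ h₁ y ^ 2 ∂μ ≤ ∫ y, kernelOp k μ h₁ y ^ 2 ∂μ :=
          setIntegral_le_integral hsq (ae_of_all _ fun y => sq_nonneg _)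
      _ ≤ A * ∫ y, h₁ y ^ 2 ∂μ := hT h₁ hm₁ hb₁
      _ ≤ A * ∫ y, B'.indicator (fun _ => (1 : ℝ)) y ∂μ := by
          refine mul_le_mul_of_nonneg_left (integral_mono
            (integrable_of_abs_le (hm₁.pow_const 2) (C := 1) fun y => ?_)
            ((integrable_indicator_iff hB'm).2 (integrable_const _).integrableOn) fun y => ?_) hA
          · rw [abs_pow]; exact pow_le_one₀ (abs_nonneg _) (hb₁ y)
          · by_cases hy : y ∈ B'
            · simp only [indicator_of_mem hy, ← sq_abs (h₁ y)]
              exact pow_le_one₀ (abs_nonneg _) (hb₁ y)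
            · simp [hh₁, hy]
      _ = A * μ.real B' := by rw [integral_indicator hB'm]; simp
      _ ≤ A * (2 * 50 ^ n * μ.real B) := by gcongr
      _ = _ := by ring
  linarith

end Operator

/-- A comparison of measures on enlarged balls passes to the union of the balls. -/
lemma exists_measure_cover_le {X : Type*} [PseudoMetricSpace X] [SecondCountableTopology X]
    [MeasurableSpace X] [BorelSpace X] {ν θ : Measure X} {P : Set X} {r : X → ℝ} {R : ℝ}
    (hr : ∀ x ∈ P, 0 < r x) (hR : ∀ x ∈ P, r x ≤ R)
    (h : ∀ x ∈ P, ν (closedBall x (5 * r x)) ≤ θ (closedBall x (r x))) :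
    ∃ U, MeasurableSet U ∧ (∀ x ∈ P, closedBall x (r x) ⊆ U) ∧ ν U ≤ θ univ := by
  obtain ⟨u, huP, hdisj, hcov⟩ :=
    Vitali.exists_disjoint_subfamily_covering_enlargement_closedBall P id r R hR 5 (by norm_num)
  simp only [id] at hdisj hcov
  have hcount : u.Countable := hdisj.countable_of_nonempty_interior fun x hx =>
    ⟨x, ball_subset_interior_closedBall (mem_ball_self (hr x (huP hx)))⟩
  refine ⟨⋃ x ∈ u, closedBall x (5 * r x),
    MeasurableSet.biUnion hcount fun x _ => measurableSet_closedBall, fun x hx => ?_, ?_⟩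
  · obtain ⟨b, hb, hxb⟩ := hcov x hx
    exact hxb.trans (subset_biUnion_of_mem (u := fun x => closedBall x (5 * r x)) hb)
  · calc ν (⋃ x ∈ u, closedBall x (5 * r x))
        ≤ ∑' x : u, ν (closedBall (x : X) (5 * r x)) := measure_biUnion_le ν hcount _
      _ ≤ ∑' x : u, θ (closedBall (x : X) (r x)) := ENNReal.tsum_le_tsum fun x => h x (huP x.2)
      _ = θ (⋃ x ∈ u, closedBall x (r x)) :=
          (measure_biUnion hcount hdisj fun x _ => measurableSet_closedBall).symm
      _ ≤ θ univ := measure_mono (subset_univ _)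

lemma lintegral_Ioi_div_sq {K τ : ℝ} (hK : 0 ≤ K) (hτ : 0 < τ) :
    ∫⁻ t in Ioi τ, ENNReal.ofReal (K / t ^ 2) = ENNReal.ofReal (K / τ) := by
  have heq : ∀ t ∈ Ioi τ, K / t ^ 2 = K * t ^ (-2 : ℝ) := fun t ht => by
    rw [Real.rpow_neg (hτ.trans ht).le, div_eq_mul_inv]
    norm_num
  have hint : IntegrableOn (fun t : ℝ => K * t ^ (-2 : ℝ)) (Ioi τ) :=
    (integrableOn_Ioi_rpow_of_lt (by norm_num) hτ).const_mul K
  rw [setLIntegral_congr_fun measurableSet_Ioi fun t ht => by rw [heq t ht],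
    ← ofReal_integral_eq_lintegral_ofReal hint ((ae_restrict_iff' measurableSet_Ioi).2
      (ae_of_all _ fun t ht => mul_nonneg hK (Real.rpow_nonneg (hτ.trans ht).le _))),
    integral_const_mul, integral_Ioi_rpow_of_lt (by norm_num) hτ]
  congr 1
  norm_num [Real.rpow_neg_one]
  rfl

/-- Integrability of functions in weak `L²` over finite measures. -/
lemma lintegral_le_of_weak_two {α : Type*} [MeasurableSpace α] {ν : Measure α} {G : α → ℝ}
    (hG : Measurable G) (hG0 : ∀ x, 0 ≤ G x) {K τ : ℝ} (hK : 0 ≤ K) (hτ : 0 < τ)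
    (h : ∀ t, 0 < t → ν {x | t < G x} ≤ ENNReal.ofReal (K / t ^ 2)) :
    ∫⁻ x, ENNReal.ofReal (G x) ∂ν ≤ ENNReal.ofReal τ * ν univ + ENNReal.ofReal (K / τ) := by
  rw [lintegral_eq_lintegral_meas_lt ν (ae_of_all _ hG0) hG.aemeasurable,
    ← Ioc_union_Ioi_eq_Ioi hτ.le]
  refine (lintegral_union_le _ _ _).trans (add_le_add ?_ ?_)
  · calc ∫⁻ t in Ioc 0 τ, ν {x | t < G x} ≤ ∫⁻ _ in Ioc 0 τ, ν univ :=
          lintegral_mono fun t => measure_mono (subset_univ _)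
      _ = ENNReal.ofReal τ * ν univ := by simp [mul_comm]
  · rw [← lintegral_Ioi_div_sq hK hτ]
    exact setLIntegral_mono_ae (by fun_prop) (ae_of_all _ fun t ht => h t (hτ.trans ht))

/-- The additive constant in the comparison with means over doubling balls. -/
def oscConst (n : ℕ) (L c A : ℝ) : ℝ :=
  c + 3 * 50 ^ n * c + L * c * 2 ^ (n + 1) + (1 + A * (2 * 50 ^ n))

/-- The constant of the weak type `(1,1)` inequality. -/
def weakConst (n : ℕ) (L c A : ℝ) : ℝ :=
  1 + 2 * (oscConst n L c A + (2 * (A * (2 * 50 ^ n)) + 1))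

section Weak
variable {E : Type*} [NormedAddCommGroup E] {n : ℕ} {ε L c A : ℝ} {k : E → ℝ}
variable [MeasurableSpace E] [BorelSpace E] [SecondCountableTopology E] {μ : Measure E}

lemma oscConst_pos (hL : 0 ≤ L) (hc : 0 ≤ c) (hA : 0 ≤ A) : 0 < oscConst n L c A := by
  unfold oscConst; positivity

lemma weakConst_pos (hL : 0 ≤ L) (hc : 0 ≤ c) (hA : 0 ≤ A) : 1 ≤ weakConst n L c A := by
  have := oscConst_pos (n := n) hL hc hA
  unfold weakConst
  have : 0 ≤ A * (2 * 50 ^ n) := by positivity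
  linarith

/-- The integral of `kernelOp k μ h` against `ν`, for `h` vanishing near the balls on which `ν` is
large compared to `μ`. -/
lemma integral_abs_kernelOp_le [IsFiniteMeasure μ] {ν : Measure E} [IsFiniteMeasure ν]
    (hk : OddCZKernel n ε L k) (hε : 0 < ε) (hL : 0 ≤ L) (hc : 0 ≤ c) (hA : 0 ≤ A)
    (hμ : ∀ (x : E) (r : ℝ), 0 < r → μ.real (closedBall x r) ≤ c * r ^ n)
    (hT : ∀ u : E → ℝ, Measurable u → (∀ y, |u y| ≤ 1) →
      ∫ x, kernelOp k μ u x ^ 2 ∂μ ≤ A * ∫ x, u x ^ 2 ∂μ)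
    {N : ℝ} (hN : 0 < N) (hμN : μ (closedBall 0 N)ᶜ = 0) (hνN : ν (closedBall 0 N)ᶜ = 0)
    {l : ℝ} (hl : 0 < l) (hlt : ν.real univ < l * μ.real univ)
    {h : E → ℝ} (hh : Measurable h) (hh1 : ∀ y, |h y| ≤ 1)
    (hs : ∀ x ∈ closedBall (0 : E) N, ∃ s, 0 < s ∧ (s = ε ∨ ∀ y ∈ closedBall x s, h y = 0) ∧
      ∀ r, s ≤ r → ν.real (closedBall x r) ≤ l * μ.real (closedBall x (10 * r)))
    {τ : ℝ} (hτ : 0 < τ) :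
    ∫ x, |kernelOp k μ h x| ∂ν ≤
      (oscConst n L c A + τ) * ν.real univ +
        l * (2 * 50 ^ n) * (A * ∫ x, h x ^ 2 ∂μ) / τ := by
  set C₀ := oscConst n L c A with hC₀
  have hC₀pos : 0 < C₀ := oscConst_pos hL hc hA
  set D : ℝ := 2 * 50 ^ n with hD
  have hD1 : 1 ≤ D := by
    have : (1 : ℝ) ≤ 50 ^ n := one_le_pow₀ (by norm_num)
    linarith
  set g := kernelOp k μ h with hg
  have hgm : Measurable g := hk.measurable_kernelOp hh
  have hi : Integrable h μ := integrable_of_abs_le hh hh1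
  have hgb : ∀ x, |g x| ≤ (ε ^ n)⁻¹ * ∫ y, |h y| ∂μ := hk.abs_kernelOp_le hε hi
  have hμ0 : 0 < μ.real univ := by
    have : 0 ≤ ν.real univ := measureReal_nonneg
    by_contra hcon
    nlinarith
  have hg2 : ∀ S, IntegrableOn (fun y => g y ^ 2) S μ := fun S =>
    (integrable_of_abs_le (hgm.pow_const 2) fun y => by
      rw [abs_pow]; exact pow_le_pow_left₀ (abs_nonneg _) (hgb y) 2).integrableOn
  have hg1 : ∀ S, IntegrableOn (fun y => |g y|) S μ := fun S =>
    (integrable_of_abs_le hgm.abs fun y => by rw [abs_abs]; exact hgb y).integrableOn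
  have hfull : ∀ x ∈ closedBall (0 : E) N, ∀ r, 2 * N ≤ r → μ.restrict (closedBall x r) = μ := by
    intro x hx r hr
    refine Measure.restrict_eq_self_of_ae_mem ((ae_iff).2 (measure_mono_null ?_ hμN))
    intro y hy hy'
    refine hy (mem_closedBall.2 ?_)
    have h1 := mem_closedBall.1 hx
    have h2 := mem_closedBall.1 hy'
    have h3 := dist_triangle_right y x 0
    linarith
  have hweak : ∀ t, 0 < t → ν {x | t < max (|g x| - C₀) 0} ≤
      ENNReal.ofReal (l * D * (A * ∫ x, h x ^ 2 ∂μ) / t ^ 2) := by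
    intro t ht
    have hball : ∀ x, ∃ ρ, x ∈ closedBall (0 : E) N ∩ {x | C₀ + t < |g x|} →
        0 < ρ ∧ ρ ≤ 2 * N ∧ ν.real (closedBall x (5 * ρ)) ≤ l * D * μ.real (closedBall x ρ) ∧
        t ^ 2 * μ.real (closedBall x ρ) ≤ ∫ y in closedBall x ρ, g y ^ 2 ∂μ := by
      intro x
      by_cases hx : x ∈ closedBall (0 : E) N ∩ {x | C₀ + t < |g x|}
      swap
      · exact ⟨0, fun h => absurd h hx⟩
      obtain ⟨s, hs0, hxs, hsν⟩ := hs x hx.1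
      obtain ⟨ρ, hsρ, hpos, hdoub, hmean⟩ :=
        exists_doubling_kernelOp_le hk hε hL hc hA hμ hT hμ0 hh hh1 hs0 hxs
      have hρ0 : 0 < ρ := hs0.trans_le hsρ
      have hxt : C₀ + t < |g x| := hx.2
      have e1 : t * μ.real (closedBall x ρ) ≤ ∫ y in closedBall x ρ, |g y| ∂μ := by
        have : μ.real (closedBall x ρ) * (C₀ + t) ≤ μ.real (closedBall x ρ) * |g x| := by gcongr
        change μ.real (closedBall x ρ) * |g x| ≤ C₀ * _ + _ at hmean
        linarith
      have e2 : t ^ 2 * μ.real (closedBall x ρ) ≤ ∫ y in closedBall x ρ, g y ^ 2 ∂μ := by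
        have e3 : ∫ y in closedBall x ρ, 2 * t * |g y| ∂μ ≤
            ∫ y in closedBall x ρ, (t ^ 2 + g y ^ 2) ∂μ :=
          setIntegral_mono ((hg1 _).const_mul _) ((integrable_const _).integrableOn.add (hg2 _))
            fun y => by nlinarith [sq_nonneg (|g y| - t), sq_abs (g y)]
        rw [integral_const_mul, integral_add (integrable_const _) (hg2 _), setIntegral_const,
          smul_eq_mul] at e3
        nlinarith
      have e4 : ν.real (closedBall x (5 * ρ)) ≤ l * D * μ.real (closedBall x ρ) := by
        calc _ ≤ l * μ.real (closedBall x (10 * (5 * ρ))) := hsν _ (by linarith)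
          _ = l * μ.real (closedBall x (50 * ρ)) := by congr 3; ring
          _ ≤ l * (D * μ.real (closedBall x ρ)) := by gcongr
          _ = _ := by ring
      by_cases hρN : ρ ≤ 2 * N
      · exact ⟨ρ, fun _ => ⟨hρ0, hρN, e4, e2⟩⟩
      · have e5 : μ.restrict (closedBall x ρ) = μ.restrict (closedBall x (2 * N)) := by
          rw [hfull x hx.1 ρ (not_le.1 hρN).le, hfull x hx.1 _ le_rfl]
        have e6 : μ.real (closedBall x ρ) = μ.real (closedBall x (2 * N)) := by
          have := congrArg (fun m : Measure E => m.real univ) e5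
          simpa using this
        refine ⟨2 * N, fun _ => ⟨by linarith, le_rfl, ?_, ?_⟩⟩
        · refine (measureReal_mono (closedBall_subset_closedBall ?_)).trans (e6 ▸ e4)
          linarith
        · rw [← e6, ← e5]; exact e2
    choose ρ hρ using hball
    set θ : Measure E := ENNReal.ofReal (l * D / t ^ 2) •
      μ.withDensity fun y => ENNReal.ofReal (g y ^ 2) with hθ
    have hθS : ∀ S, MeasurableSet S →
        θ S = ENNReal.ofReal (l * D / t ^ 2 * ∫ y in S, g y ^ 2 ∂μ) := fun S hS => by
      rw [hθ, Measure.smul_apply, withDensity_apply _ hS, smul_eq_mul,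
        ← ofReal_integral_eq_lintegral_ofReal (hg2 S) (ae_of_all _ fun y => sq_nonneg _),
        ENNReal.ofReal_mul (by positivity)]
    obtain ⟨U, -, hU, hνU⟩ := exists_measure_cover_le (ν := ν) (θ := θ)
      (P := closedBall (0 : E) N ∩ {x | C₀ + t < |g x|}) (r := ρ) (R := 2 * N)
      (fun x hx => (hρ x hx).1) (fun x hx => (hρ x hx).2.1) fun x hx => by
        obtain ⟨-, -, h1, h2⟩ := hρ x hx
        rw [hθS _ measurableSet_closedBall, ← ofReal_measureReal]
        refine ENNReal.ofReal_le_ofReal (h1.trans ?_)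
        calc _ = l * D / t ^ 2 * (t ^ 2 * μ.real (closedBall x (ρ x))) := by field_simp
          _ ≤ _ := by gcongr
    have hsub : {x | t < max (|g x| - C₀) 0} ⊆ U ∪ (closedBall (0 : E) N)ᶜ := by
      intro x hx
      by_cases hxN : x ∈ closedBall (0 : E) N
      · refine Or.inl (hU x ⟨hxN, ?_⟩ (mem_closedBall_self (hρ x ⟨hxN, ?_⟩).1.le))
        all_goals
          have hx' : t < max (|g x| - C₀) 0 := hx
          rcases lt_max_iff.1 hx' with h | h
          · change C₀ + t < |g x|
            linarith
          · linarith
      · exact Or.inr hxN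
    calc ν {x | t < max (|g x| - C₀) 0} ≤ ν U + ν (closedBall (0 : E) N)ᶜ :=
          (measure_mono hsub).trans (measure_union_le _ _)
      _ ≤ θ univ := by rw [hνN, add_zero]; exact hνU
      _ = ENNReal.ofReal (l * D / t ^ 2 * ∫ y, g y ^ 2 ∂μ) := by
          rw [hθS _ MeasurableSet.univ, setIntegral_univ]
      _ ≤ _ := by
          refine ENNReal.ofReal_le_ofReal ?_
          calc _ ≤ l * D / t ^ 2 * (A * ∫ x, h x ^ 2 ∂μ) := by
                gcongr; exact hT h hh hh1
            _ = _ := by ring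
  have hh2 : 0 ≤ ∫ x, h x ^ 2 ∂μ := integral_nonneg fun x => sq_nonneg _
  have hGm : Measurable fun x => max (|g x| - C₀) 0 := (hgm.abs.sub_const _).max measurable_const
  have hlint := lintegral_le_of_weak_two hGm (fun x => le_max_right _ _) (by positivity) hτ hweak
  have hGi : Integrable (fun x => max (|g x| - C₀) 0) ν :=
    integrable_of_abs_le hGm (C := (ε ^ n)⁻¹ * ∫ y, |h y| ∂μ) fun x => by
      rw [abs_of_nonneg (le_max_right _ _)]
      exact max_le (by linarith [hgb x]) ((abs_nonneg _).trans (hgb x))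
  have hGint : ∫ x, max (|g x| - C₀) 0 ∂ν ≤
      τ * ν.real univ + l * D * (A * ∫ x, h x ^ 2 ∂μ) / τ := by
    rw [← ofReal_integral_eq_lintegral_ofReal hGi (ae_of_all _ fun x => le_max_right _ _),
      ← ofReal_measureReal, ← ENNReal.ofReal_mul hτ.le, ← ENNReal.ofReal_add (by positivity)
      (by positivity)] at hlint
    exact (ENNReal.ofReal_le_ofReal_iff (by positivity)).1 hlint
  calc ∫ x, |g x| ∂ν ≤ ∫ x, (C₀ + max (|g x| - C₀) 0) ∂ν := by
        refine integral_mono (integrable_of_abs_le hgm.abs fun y => by rw [abs_abs]; exact hgb y)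
          ((integrable_const _).add hGi) fun x => ?_
        have := le_max_left (|g x| - C₀) 0
        simp only
        linarith
    _ = C₀ * ν.real univ + ∫ x, max (|g x| - C₀) 0 ∂ν := by
        rw [integral_add (integrable_const _) hGi]
        simp [mul_comm]
    _ ≤ _ := by linarith

/-- The weak type `(1,1)` inequality for finite measures. -/
lemma measureReal_lt_integral_kernel_le [IsFiniteMeasure μ] {ν : Measure E} [IsFiniteMeasure ν]
    (hk : OddCZKernel n ε L k) (hε : 0 < ε) (hL : 0 ≤ L) (hc : 0 ≤ c) (hA : 0 ≤ A)
    (hμ : ∀ (x : E) (r : ℝ), 0 < r → μ.real (closedBall x r) ≤ c * r ^ n)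
    (hT : ∀ u : E → ℝ, Measurable u → (∀ y, |u y| ≤ 1) →
      ∫ x, kernelOp k μ u x ^ 2 ∂μ ≤ A * ∫ x, u x ^ 2 ∂μ)
    {N : ℝ} (hN : 0 < N) (hμN : μ (closedBall 0 N)ᶜ = 0) (hνN : ν (closedBall 0 N)ᶜ = 0)
    {l : ℝ} (hl : 0 < l) :
    μ.real {x | l < ∫ y, k (x - y) ∂ν} ≤ weakConst n L c A / l * ν.real univ := by
  have hW : 1 ≤ weakConst n L c A := weakConst_pos hL hc hA
  rcases le_or_gt (l * μ.real univ) (ν.real univ) with hle | hlt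
  · calc μ.real {x | l < ∫ y, k (x - y) ∂ν} ≤ μ.real univ := measureReal_mono (subset_univ _)
      _ ≤ 1 / l * ν.real univ := by
          rw [one_div, inv_mul_eq_div, le_div_iff₀ hl]; linarith
      _ ≤ _ := by gcongr
  set bad : E → Set ℝ := fun x =>
    {r | 0 < r ∧ l * μ.real (closedBall x (10 * r)) < ν.real (closedBall x r)} with hbad
  have hbadN : ∀ x ∈ closedBall (0 : E) N, ∀ r ∈ bad x, r ≤ 2 * N := by
    intro x hx r hr
    by_contra! hcon
    have hsub : (closedBall x (10 * r))ᶜ ⊆ (closedBall (0 : E) N)ᶜ := by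
      intro y hy hy'
      refine hy (mem_closedBall.2 ?_)
      have h1 := mem_closedBall.1 hx
      have h2 := mem_closedBall.1 hy'
      have h3 := dist_triangle_right y x 0
      linarith [hr.1]
    have h1 : μ.real (closedBall x (10 * r)) = μ.real univ := by
      rw [measureReal_def, measureReal_def, measure_of_measure_compl_eq_zero
        (measure_mono_null hsub hμN)]
    have h2 : ν.real (closedBall x r) ≤ ν.real univ := measureReal_mono (subset_univ _)
    have h3 := hr.2
    rw [h1] at h3
    linarith
  set P : Set E := {x ∈ closedBall (0 : E) N | (bad x).Nonempty} with hP
  have hchoose : ∀ x, ∃ r, x ∈ P → r ∈ bad x ∧ ∀ r' ∈ bad x, r' < 2 * r := by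
    intro x
    by_cases hx : x ∈ P
    swap
    · exact ⟨0, fun h => absurd h hx⟩
    obtain ⟨r₀, hr₀⟩ := hx.2
    have hbdd : BddAbove (bad x) := ⟨2 * N, hbadN x hx.1⟩
    have hpos : 0 < sSup (bad x) := hr₀.1.trans_le (le_csSup hbdd hr₀)
    obtain ⟨r, hr, hlt⟩ := exists_lt_of_lt_csSup hx.2 (half_lt_self hpos)
    exact ⟨r, fun _ => ⟨hr, fun r' hr' => by linarith [le_csSup hbdd hr']⟩⟩
  choose r hr using hchoose
  obtain ⟨U, hUm, hU, hμU⟩ := exists_measure_cover_le (ν := μ) (θ := ENNReal.ofReal l⁻¹ • ν)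
    (P := P) (r := fun x => 2 * r x) (R := 4 * N)
    (fun x hx => by linarith [(hr x hx).1.1])
    (fun x hx => by linarith [hbadN x hx.1 _ (hr x hx).1]) fun x hx => by
      obtain ⟨⟨h1, h2⟩, -⟩ := hr x hx
      rw [Measure.smul_apply, smul_eq_mul, ← ofReal_measureReal, ← ofReal_measureReal,
        ← ENNReal.ofReal_mul (by positivity)]
      refine ENNReal.ofReal_le_ofReal ?_
      rw [inv_mul_eq_div, le_div_iff₀ hl, mul_comm, ← mul_assoc]
      norm_num
      exact h2.le.trans (measureReal_mono (closedBall_subset_closedBall (by linarith)))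
  have hμU' : μ.real U ≤ 1 / l * ν.real univ := by
    rw [Measure.smul_apply, smul_eq_mul, ← ofReal_measureReal, ← ofReal_measureReal,
        ← ENNReal.ofReal_mul (by positivity), ENNReal.ofReal_le_ofReal_iff (by positivity)] at hμU
    rwa [one_div]
  have hker : StronglyMeasurable (Function.uncurry fun x y : E => k (x - y)) :=
    (hk.continuous.measurable.comp (measurable_fst.sub measurable_snd)).stronglyMeasurable
  have hTm : Measurable fun x => ∫ y, k (x - y) ∂ν := hker.integral_prod_right.measurable
  set F : Set E := {x | l < ∫ y, k (x - y) ∂ν} \ U with hF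
  have hFm : MeasurableSet F := (measurableSet_lt measurable_const hTm).diff hUm
  set h : E → ℝ := F.indicator fun _ => 1 with hh
  have hhm : Measurable h := measurable_const.indicator hFm
  have hh1 : ∀ y, |h y| ≤ 1 := fun y => by by_cases hy : y ∈ F <;> simp [hh, hy]
  have hh2 : ∫ x, h x ^ 2 ∂μ = μ.real F := by
    have : (fun x => h x ^ 2) = F.indicator fun _ => 1 := by
      ext x; by_cases hx : x ∈ F <;> simp [hh, hx]
    rw [this, integral_indicator hFm]; simp
  have hs : ∀ x ∈ closedBall (0 : E) N, ∃ s, 0 < s ∧ (s = ε ∨ ∀ y ∈ closedBall x s, h y = 0) ∧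
      ∀ r, s ≤ r → ν.real (closedBall x r) ≤ l * μ.real (closedBall x (10 * r)) := by
    intro x hx
    by_cases hxP : x ∈ P
    · obtain ⟨hrx, hmax⟩ := hr x hxP
      have hgood : ∀ r', 2 * r x ≤ r' →
          ν.real (closedBall x r') ≤ l * μ.real (closedBall x (10 * r')) := by
        intro r' hr'
        by_contra! hcon
        exact absurd (hmax r' ⟨by linarith [hrx.1], hcon⟩) (not_lt.2 hr')
      rcases le_total ε (2 * r x) with hle | hle
      · refine ⟨2 * r x, by linarith [hrx.1], Or.inr fun y hy => ?_, hgood⟩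
        exact indicator_of_notMem (fun hyF => hyF.2 (hU x hxP hy)) _
      · exact ⟨ε, hε, Or.inl rfl, fun r' hr' => hgood r' (hle.trans hr')⟩
    · refine ⟨ε, hε, Or.inl rfl, fun r' hr' => ?_⟩
      by_contra! hcon
      exact hxP ⟨hx, r', hε.trans_le hr', hcon⟩
  have hA' : 0 ≤ A * (2 * 50 ^ n) := by positivity
  have hmain := integral_abs_kernelOp_le hk hε hL hc hA hμ hT hN hμN hνN hl hlt hhm hh1 hs
    (τ := 2 * (A * (2 * 50 ^ n)) + 1) (by positivity)
  rw [hh2] at hmain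
  have hfub : ∫ x, h x * ∫ y, k (x - y) ∂ν ∂μ = - ∫ y, kernelOp k μ h y ∂ν := by
    have hint : Integrable (Function.uncurry fun x y : E => h x * k (x - y)) (μ.prod ν) :=
      integrable_of_abs_le ((hhm.comp measurable_fst).mul hker.measurable) (C := (ε ^ n)⁻¹)
        fun p => by
          change |h p.1 * k (p.1 - p.2)| ≤ _
          rw [abs_mul]
          calc _ ≤ 1 * (ε ^ n)⁻¹ := by gcongr; exacts [hh1 _, hk.abs_le hε _]
            _ = _ := one_mul _
    simp only [← integral_const_mul]
    rw [integral_integral_swap hint, ← integral_neg]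
    refine integral_congr_ae (ae_of_all _ fun y => ?_)
    simp only [kernelOp, ← integral_neg]
    refine integral_congr_ae (ae_of_all _ fun x => ?_)
    simp only
    rw [← neg_sub y x, hk.odd]; ring
  have hlow : l * μ.real F ≤ ∫ x, h x * ∫ y, k (x - y) ∂ν ∂μ := by
    have hb : ∀ x, |∫ y, k (x - y) ∂ν| ≤ (ε ^ n)⁻¹ * ν.real univ := fun x => by
      rw [← Real.norm_eq_abs]
      exact norm_integral_le_of_norm_le_const (ae_of_all _ fun y => hk.abs_le hε _)
    calc l * μ.real F = ∫ x, l * h x ^ 2 ∂μ := by rw [integral_const_mul, hh2]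
      _ ≤ _ := by
        refine integral_mono (integrable_of_abs_le ((hhm.pow_const 2).const_mul l) (C := l)
          fun x => ?_) (integrable_of_abs_le (hhm.mul hTm) (C := (ε ^ n)⁻¹ * ν.real univ)
          fun x => ?_) fun x => ?_
        · rw [abs_mul, abs_of_pos hl, abs_pow]
          exact mul_le_of_le_one_right hl.le (pow_le_one₀ (abs_nonneg _) (hh1 x))
        · simp only [abs_mul]
          exact (mul_le_of_le_one_left (abs_nonneg _) (hh1 x)).trans (hb x)
        · by_cases hx : x ∈ F
          · have : l < ∫ y, k (x - y) ∂ν := hx.1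
            simp [hh, hx, this.le]
          · simp [hh, hx]
  have hneg : - ∫ y, kernelOp k μ h y ∂ν ≤ ∫ y, |kernelOp k μ h y| ∂ν :=
    (neg_le_abs _).trans abs_integral_le_integral_abs
  have hμF : 0 ≤ μ.real F := measureReal_nonneg
  have habsorb : l * (2 * 50 ^ n) * (A * μ.real F) / (2 * (A * (2 * 50 ^ n)) + 1) ≤
      l * μ.real F / 2 := by
    rw [div_le_div_iff₀ (by positivity) (by positivity)]
    nlinarith [mul_nonneg hl.le hμF]
  have hFle : μ.real F ≤
      2 * (oscConst n L c A + (2 * (A * (2 * 50 ^ n)) + 1)) / l * ν.real univ := by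
    rw [div_mul_eq_mul_div, le_div_iff₀ hl]
    linarith
  calc μ.real {x | l < ∫ y, k (x - y) ∂ν} ≤ μ.real (U ∪ F) :=
        measureReal_mono fun x hx => by
          by_cases hxU : x ∈ U
          exacts [Or.inl hxU, Or.inr ⟨hx, hxU⟩]
    _ ≤ μ.real U + μ.real F := measureReal_union_le _ _
    _ ≤ 1 / l * ν.real univ +
        2 * (oscConst n L c A + (2 * (A * (2 * 50 ^ n)) + 1)) / l * ν.real univ := by gcongr
    _ = _ := by rw [weakConst]; ring

end Weak

/-- A Marcinkiewicz type estimate between weak `L¹` and weak `L²`. -/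
lemma integral_sqrt_pow_three_le {α : Type*} [MeasurableSpace α] {ν : Measure α}
    [IsFiniteMeasure ν] {v : α → ℝ} (hv : Measurable v) {W a m : ℝ} (hW : 0 < W) (ha : 0 < a)
    (hm : 0 ≤ m) (h1 : ∀ t, 0 < t → ν.real {x | t < |v x|} ≤ W * m / t)
    (h2 : ∀ t, 0 < t → ν.real {x | t < |v x|} ≤ a * m / t ^ 2) :
    ∫ x, √|v x| ^ 3 ∂ν ≤ 6 * √(a * W) * m := by
  have hw : Measurable fun x => √|v x| := hv.abs.sqrt
  set τ := √(a / W) with hτ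
  have hτ0 : 0 < τ := Real.sqrt_pos.2 (by positivity)
  have hWτ : W * τ = √(a * W) := by
    rw [hτ, ← Real.sqrt_sq hW.le, ← Real.sqrt_mul (by positivity), Real.sqrt_sq hW.le]
    congr 1; field_simp
  have haτ : a / τ = √(a * W) := by
    rw [div_eq_iff hτ0.ne', hτ, ← Real.sqrt_mul (by positivity),
      show a * W * (a / W) = a ^ 2 by field_simp, Real.sqrt_sq ha.le]
  have hset : ∀ t : ℝ, 0 < t → {x | t < √|v x|} = {x | t ^ 2 < |v x|} := fun t ht => by
    ext x; simp [Real.lt_sqrt ht.le]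
  have hb1 : ∀ t : ℝ, 0 < t →
      ν {x | t < √|v x|} * ENNReal.ofReal (t ^ (3 - 1 : ℝ)) ≤ ENNReal.ofReal (W * m) := by
    intro t ht
    rw [hset t ht, ← ofReal_measureReal, ← ENNReal.ofReal_mul measureReal_nonneg]
    refine ENNReal.ofReal_le_ofReal ?_
    have := h1 (t ^ 2) (by positivity)
    rw [le_div_iff₀ (by positivity)] at this
    refine le_trans (le_of_eq ?_) this
    norm_num
  have hb2 : ∀ t : ℝ, 0 < t →
      ν {x | t < √|v x|} * ENNReal.ofReal (t ^ (3 - 1 : ℝ)) ≤ ENNReal.ofReal (a * m / t ^ 2) := by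
    intro t ht
    rw [hset t ht, ← ofReal_measureReal, ← ENNReal.ofReal_mul measureReal_nonneg]
    refine ENNReal.ofReal_le_ofReal ?_
    have := h2 (t ^ 2) (by positivity)
    rw [le_div_iff₀ (by positivity)] at this ⊢
    refine le_trans (le_of_eq ?_) this
    norm_num
    ring
  have hlint : ∫⁻ x, ENNReal.ofReal (√|v x| ^ 3) ∂ν ≤ ENNReal.ofReal (6 * √(a * W) * m) := by
    have := lintegral_rpow_eq_lintegral_meas_lt_mul ν (f := fun x => √|v x|)
      (ae_of_all _ fun x => Real.sqrt_nonneg _) hw.aemeasurable (p := 3) (by norm_num)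
    have h3 : ∀ x, √|v x| ^ (3 : ℝ) = √|v x| ^ 3 := fun x => by
      exact_mod_cast Real.rpow_natCast (√|v x|) 3
    simp only [h3] at this
    rw [this, ← Ioc_union_Ioi_eq_Ioi hτ0.le]
    have hA : ∫⁻ t in Ioc 0 τ, ν {x | t < √|v x|} * ENNReal.ofReal (t ^ (3 - 1 : ℝ)) ≤
        ENNReal.ofReal (√(a * W) * m) := by
      calc _ ≤ ∫⁻ _ in Ioc 0 τ, ENNReal.ofReal (W * m) :=
            setLIntegral_mono_ae (by fun_prop) (ae_of_all _ fun t ht => hb1 t ht.1)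
        _ = _ := by
            rw [setLIntegral_const, Real.volume_Ioc, sub_zero,
              ← ENNReal.ofReal_mul (by positivity), ← hWτ]
            congr 1; ring
    have hB : ∫⁻ t in Ioi τ, ν {x | t < √|v x|} * ENNReal.ofReal (t ^ (3 - 1 : ℝ)) ≤
        ENNReal.ofReal (√(a * W) * m) := by
      calc _ ≤ ∫⁻ t in Ioi τ, ENNReal.ofReal (a * m / t ^ 2) :=
            setLIntegral_mono_ae (by fun_prop) (ae_of_all _ fun t ht => hb2 t (hτ0.trans ht))
        _ = _ := by
            rw [lintegral_Ioi_div_sq (by positivity) hτ0, ← haτ]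
            congr 1; ring
    calc _ ≤ ENNReal.ofReal 3 * (ENNReal.ofReal (√(a * W) * m) +
          ENNReal.ofReal (√(a * W) * m)) := by
            gcongr
            exact (lintegral_union_le _ _ _).trans (add_le_add hA hB)
      _ = _ := by
            rw [← ENNReal.ofReal_add (by positivity) (by positivity),
              ← ENNReal.ofReal_mul (by norm_num)]
            congr 1; ring
  rw [integral_eq_lintegral_of_nonneg_ae (ae_of_all _ fun x => by positivity)
    (hw.pow_const 3).aestronglyMeasurable]
  exact ENNReal.toReal_le_of_le_ofReal (by positivity) hlint

lemma mul_sq_le_add_pow_three {x w δ : ℝ} (hx : 0 ≤ x) (hw : 0 ≤ w) (hδ : 0 < δ) :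
    x * w ^ 2 ≤ δ * w ^ 3 + x ^ 3 / δ ^ 2 := by
  rcases le_total x (δ * w) with h | h
  · have : x * w ^ 2 ≤ δ * w * w ^ 2 := by gcongr
    have h2 : 0 ≤ x ^ 3 / δ ^ 2 := by positivity
    nlinarith
  · have h1 : x * w ^ 2 ≤ x ^ 3 / δ ^ 2 := by
      rw [le_div_iff₀ (by positivity)]
      have : (δ * w) ^ 2 ≤ x ^ 2 := by gcongr
      nlinarith [mul_le_mul_of_nonneg_left this hx]
    have h2 : 0 ≤ δ * w ^ 3 := by positivity
    linarith

lemma integrable_of_integrable_sq {α : Type*} [MeasurableSpace α] {μ : Measure α}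
    [IsFiniteMeasure μ] {f : α → ℝ} (hf : Measurable f)
    (hf2 : Integrable (fun x => f x ^ 2) μ) : Integrable f μ := by
  refine ((integrable_const (1 : ℝ)).add hf2).mono' hf.aestronglyMeasurable
    (ae_of_all _ fun x => ?_)
  rw [Real.norm_eq_abs, Pi.add_apply, ← sq_abs]
  nlinarith [sq_nonneg (|f x| - 1), abs_nonneg (f x)]

section Interpolation
variable {E : Type*} [NormedAddCommGroup E] {n : ℕ} {ε L : ℝ} {k : E → ℝ}
variable [MeasurableSpace E] [BorelSpace E] [SecondCountableTopology E] {μ : Measure E}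
  [IsFiniteMeasure μ]

/-- The operators with odd kernel are antisymmetric. -/
lemma OddCZKernel.integral_mul_kernelOp (hk : OddCZKernel n ε L k) (hε : 0 < ε) {u v : E → ℝ}
    (hu : Integrable u μ) (hv : Integrable v μ) :
    ∫ x, u x * kernelOp k μ v x ∂μ = - ∫ y, v y * kernelOp k μ u y ∂μ := by
  have hint : Integrable (Function.uncurry fun x y : E => u x * (k (x - y) * v y)) (μ.prod μ) := by
    have h0 : Integrable (fun p : E × E => u p.1 * v p.2) (μ.prod μ) := hu.mul_prod hv
    refine ((h0.bdd_mul (c := (ε ^ n)⁻¹) (f := fun p : E × E => k (p.1 - p.2))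
      (hk.continuous.measurable.comp (measurable_fst.sub measurable_snd)).aestronglyMeasurable
      (ae_of_all _ fun p => hk.abs_le hε _))).congr (ae_of_all _ fun p => ?_)
    simp only [Function.uncurry]
    ring
  simp only [kernelOp, ← integral_const_mul]
  rw [integral_integral_swap hint, ← integral_neg]
  refine integral_congr_ae (ae_of_all _ fun y => ?_)
  simp only [← integral_neg]
  refine integral_congr_ae (ae_of_all _ fun x => ?_)
  simp only
  rw [← neg_sub y x, hk.odd]; ring

/-- Weak type `(1,1)` bounds with constant `W`. -/
def WeakOneOne (k : E → ℝ) (μ : Measure E) (W : ℝ) : Prop :=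
  ∀ f : E → ℝ, Measurable f → Integrable f μ → ∀ l, 0 < l →
    μ.real {x | l < |kernelOp k μ f x|} ≤ W / l * ∫ x, |f x| ∂μ

/-- Boundedness in `L²` with squared norm at most `a`. -/
def StrongTwoTwo (k : E → ℝ) (μ : Measure E) (a : ℝ) : Prop :=
  ∀ f : E → ℝ, Measurable f → Integrable (fun x => f x ^ 2) μ →
    ∫ x, kernelOp k μ f x ^ 2 ∂μ ≤ a * ∫ x, f x ^ 2 ∂μ

lemma measureReal_lt_kernelOp_le (hk : OddCZKernel n ε L k) (hε : 0 < ε) {W a : ℝ} (hW : 0 < W)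
    (ha : 0 < a) (hw : WeakOneOne k μ W) (hs : StrongTwoTwo k μ a) {u : E → ℝ}
    (hu : Measurable u) {M : ℝ} (huM : ∀ x, |u x| ≤ M) {l : ℝ} (hl : 0 < l) :
    μ.real {x | l < kernelOp k μ u x} ≤ 288 * a * W / l ^ 3 * ∫ x, |u x| ^ 3 ∂μ := by
  have hui : Integrable u μ := integrable_of_abs_le hu huM
  have hTu := hk.measurable_kernelOp (μ := μ) hu
  set F := {x | l < kernelOp k μ u x} with hF
  have hFm : MeasurableSet F := measurableSet_lt measurable_const hTu
  set h : E → ℝ := F.indicator fun _ => 1 with hh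
  have hhm : Measurable h := measurable_const.indicator hFm
  have hh1 : ∀ y, |h y| ≤ 1 := fun y => by by_cases hy : y ∈ F <;> simp [hh, hy]
  have hhi : Integrable h μ := integrable_of_abs_le hhm hh1
  have hhint : ∫ x, h x ∂μ = μ.real F := by rw [integral_indicator hFm]; simp
  have hha : (fun x => |h x|) = h := by ext x; by_cases hx : x ∈ F <;> simp [hh, hx]
  have hhs : (fun x => h x ^ 2) = h := by ext x; by_cases hx : x ∈ F <;> simp [hh, hx]
  set v := kernelOp k μ h with hv
  have hvm : Measurable v := hk.measurable_kernelOp hhm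
  have hvb := hk.abs_kernelOp_le (μ := μ) hε hhi
  rw [hha, hhint] at hvb
  set V := (ε ^ n)⁻¹ * μ.real F with hV
  have hM : 0 ≤ M := (abs_nonneg _).trans (huM 0)
  have hv3 : ∫ x, √|v x| ^ 3 ∂μ ≤ 6 * √(a * W) * μ.real F := by
    refine integral_sqrt_pow_three_le hvm hW ha measureReal_nonneg (fun t ht => ?_) fun t ht => ?_
    · have := hw h hhm hhi t ht
      rw [hha, hhint] at this
      rwa [div_mul_eq_mul_div] at this
    · have h2 := hs h hhm (by rw [hhs]; exact hhi)
      rw [hhs, hhint] at h2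
      rw [le_div_iff₀ (by positivity)]
      refine le_trans ?_ h2
      have hsub : {x | t < |v x|} ⊆ {x | t ^ 2 ≤ v x ^ 2} := fun x hx => by
        have : t < |v x| := hx
        change t ^ 2 ≤ v x ^ 2
        rw [← sq_abs (v x)]; gcongr
      have := mul_meas_ge_le_integral_of_nonneg (μ := μ) (f := fun x => v x ^ 2)
        (ae_of_all _ fun x => sq_nonneg _) (integrable_of_abs_le (hvm.pow_const 2) (C := V ^ 2)
          fun x => by rw [abs_pow]; gcongr; exact hvb x) (t ^ 2)
      rw [mul_comm]
      refine le_trans ?_ this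
      exact mul_le_mul_of_nonneg_left (measureReal_mono hsub) (by positivity)
  have hq : 0 < √(a * W) := Real.sqrt_pos.2 (by positivity)
  have hqq : √(a * W) ^ 2 = a * W := Real.sq_sqrt (by positivity)
  set q := √(a * W) with hqdef
  set δ := l / (12 * q) with hδ
  have hδ0 : 0 < δ := by positivity
  have h3i : Integrable (fun x => |u x| ^ 3) μ := integrable_of_abs_le (hu.abs.pow_const 3)
    (C := M ^ 3) fun x => by rw [abs_pow, abs_abs]; gcongr; exact huM x
  have hw3i : Integrable (fun x => √|v x| ^ 3) μ :=
    integrable_of_abs_le (hvm.abs.sqrt.pow_const 3) (C := √V ^ 3) fun x => by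
      rw [abs_pow, abs_of_nonneg (Real.sqrt_nonneg _)]
      gcongr; exact hvb x
  have huv : - ∫ x, u x * v x ∂μ ≤ δ * ∫ x, √|v x| ^ 3 ∂μ + (∫ x, |u x| ^ 3 ∂μ) / δ ^ 2 := by
    rw [← integral_neg, ← integral_const_mul, ← integral_div, ← integral_add (hw3i.const_mul _)
      (h3i.div_const _)]
    refine integral_mono (integrable_of_abs_le (hu.mul hvm).neg (C := M * V) fun x => ?_)
      ((hw3i.const_mul _).add (h3i.div_const _)) fun x => ?_
    · simp only [abs_neg, abs_mul]
      gcongr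
      exacts [huM x, hvb x]
    · calc -(u x * v x) ≤ |u x| * |v x| := by rw [← abs_mul]; exact neg_le_abs _
        _ = |u x| * √|v x| ^ 2 := by rw [Real.sq_sqrt (abs_nonneg _)]
        _ ≤ _ := mul_sq_le_add_pow_three (abs_nonneg _) (Real.sqrt_nonneg _) hδ0
  have hlow : l * μ.real F ≤ ∫ x, h x * kernelOp k μ u x ∂μ := by
    rw [← hhint, ← integral_const_mul]
    have hTb := hk.abs_kernelOp_le (μ := μ) hε hui
    refine integral_mono (hhi.const_mul l) (integrable_of_abs_le (hhm.mul hTu)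
      (C := 1 * ((ε ^ n)⁻¹ * ∫ y, |u y| ∂μ)) fun x => ?_) fun x => ?_
    · rw [abs_mul]
      gcongr
      exacts [hh1 x, hTb x]
    · by_cases hx : x ∈ F
      · have : l < kernelOp k μ u x := hx
        simp [hh, hx, this.le]
      · simp [hh, hx]
  rw [hk.integral_mul_kernelOp hε hhi hui] at hlow
  have hmain : l * μ.real F ≤ l / 2 * μ.real F + 144 * (a * W) / l ^ 2 * ∫ x, |u x| ^ 3 ∂μ := by
    refine (hlow.trans huv).trans (add_le_add ?_ (le_of_eq ?_))
    · calc δ * ∫ x, √|v x| ^ 3 ∂μ ≤ δ * (6 * q * μ.real F) := by gcongr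
        _ = _ := by rw [hδ]; field_simp; ring
    · rw [hδ, ← hqq]; field_simp; norm_num
  have : l * μ.real F ≤ 288 * a * W / l ^ 2 * ∫ x, |u x| ^ 3 ∂μ := by
    have e : 288 * a * W / l ^ 2 * ∫ x, |u x| ^ 3 ∂μ =
      2 * (144 * (a * W) / l ^ 2 * ∫ x, |u x| ^ 3 ∂μ) := by ring
    rw [e]; linarith
  rw [← mul_le_mul_iff_right₀ hl]
  refine this.trans (le_of_eq ?_)
  field_simp

end Interpolation

lemma sq_integral_abs_le {α : Type*} [MeasurableSpace α] {μ : Measure α} [IsFiniteMeasure μ]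
    {f : α → ℝ} (hf : Measurable f) (hf2 : Integrable (fun x => f x ^ 2) μ) :
    (∫ x, |f x| ∂μ) ^ 2 ≤ μ.real univ * ∫ x, f x ^ 2 ∂μ := by
  have hfi := integrable_of_integrable_sq hf hf2
  set I := ∫ x, |f x| ∂μ
  set m := μ.real univ
  have h0 : 0 ≤ ∫ x, (m * |f x| - I) ^ 2 ∂μ := integral_nonneg fun x => sq_nonneg _
  have h1 : ∫ x, (m * |f x| - I) ^ 2 ∂μ = m ^ 2 * ∫ x, f x ^ 2 ∂μ - m * I ^ 2 := by
    have e : ∀ x, (m * |f x| - I) ^ 2 = m ^ 2 * f x ^ 2 - 2 * m * I * |f x| + I ^ 2 := fun x => by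
      rw [← sq_abs (f x)]; ring
    simp only [e]
    have hA : Integrable (fun x => m ^ 2 * f x ^ 2 - 2 * m * I * |f x|) μ :=
      (hf2.const_mul _).sub (hfi.abs.const_mul _)
    rw [integral_add hA (integrable_const _),
      integral_sub (hf2.const_mul _) (hfi.abs.const_mul _), integral_const_mul,
      integral_const_mul, integral_const, smul_eq_mul]
    change m ^ 2 * _ - 2 * m * I * I + m * I ^ 2 = _
    ring
  have hm : 0 ≤ m := measureReal_nonneg
  rcases hm.eq_or_lt with hm0 | hm0
  · have : μ = 0 := by
      rw [← Measure.measure_univ_eq_zero]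
      exact (measureReal_eq_zero_iff (measure_ne_top _ _)).1 hm0.symm
    simp [I, this]
  · have : m * I ^ 2 ≤ m * (m * ∫ x, f x ^ 2 ∂μ) := by rw [h1] at h0; linarith
    exact le_of_mul_le_mul_left this hm0

section Strong
variable {E : Type*} [NormedAddCommGroup E] {n : ℕ} {ε L : ℝ} {k : E → ℝ}
variable [MeasurableSpace E]

lemma kernelOp_neg (k : E → ℝ) (μ : Measure E) (f : E → ℝ) (x : E) :
    kernelOp k μ (fun y => -f y) x = -kernelOp k μ f x := by
  simp [kernelOp, integral_neg]

variable [BorelSpace E] [SecondCountableTopology E] {μ : Measure E} [IsFiniteMeasure μ]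

lemma measureReal_lt_abs_kernelOp_le (hk : OddCZKernel n ε L k) (hε : 0 < ε) {W a : ℝ}
    (hW : 0 < W) (ha : 0 < a) (hw : WeakOneOne k μ W) (hs : StrongTwoTwo k μ a) {u : E → ℝ}
    (hu : Measurable u) {M : ℝ} (huM : ∀ x, |u x| ≤ M) {l : ℝ} (hl : 0 < l) :
    μ.real {x | l < |kernelOp k μ u x|} ≤ 576 * a * W / l ^ 3 * ∫ x, |u x| ^ 3 ∂μ := by
  have h1 := measureReal_lt_kernelOp_le hk hε hW ha hw hs hu huM hl
  have h2 := measureReal_lt_kernelOp_le hk hε hW ha hw hs hu.neg (u := fun x => -u x)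
    (by simpa using huM) hl
  simp only [kernelOp_neg, abs_neg] at h2
  have hsub : {x | l < |kernelOp k μ u x|} ⊆
      {x | l < kernelOp k μ u x} ∪ {x | l < -kernelOp k μ u x} := fun x hx => by
    have hx' : l < |kernelOp k μ u x| := hx
    exact lt_abs.1 hx'
  refine (measureReal_mono hsub).trans ((measureReal_union_le _ _).trans
    ((add_le_add h1 h2).trans (le_of_eq ?_)))
  ring

lemma StrongTwoTwo.improve (hk : OddCZKernel n ε L k) (hε : 0 < ε) {W a : ℝ}
    (hW : 0 < W) (ha : 0 < a) (hw : WeakOneOne k μ W) (hs : StrongTwoTwo k μ a) :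
    StrongTwoTwo k μ (a / 2 + 73728 * W ^ 2) := by
  intro f hf hf2
  have hfi := integrable_of_integrable_sq hf hf2
  have hTm := hk.measurable_kernelOp (μ := μ) hf
  set γ := 18432 * W with hγ
  have hγ0 : 0 < γ := by positivity
  have hs1 : ∀ t, MeasurableSet {x | t ≤ γ * |f x|} := fun t =>
    measurableSet_le measurable_const (hf.abs.const_mul γ)
  have hs2 : ∀ t, MeasurableSet {x | γ * |f x| < t} := fun t =>
    measurableSet_lt (hf.abs.const_mul γ) measurable_const
  have hlevel : ∀ t, 0 < t → μ {x | t < |kernelOp k μ f x|} * ENNReal.ofReal (t ^ (2 - 1 : ℝ)) ≤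
      ∫⁻ x, {x | t ≤ γ * |f x|}.indicator (fun x => ENNReal.ofReal (2 * W * |f x|)) x ∂μ +
      ∫⁻ x, {x | γ * |f x| < t}.indicator
        (fun x => ENNReal.ofReal (4608 * a * W * |f x| ^ 3 / t ^ 2)) x ∂μ := by
    intro t ht
    set f₁ := {x | t ≤ γ * |f x|}.indicator f with hf₁
    set f₂ := {x | γ * |f x| < t}.indicator f with hf₂
    have hf₁m : Measurable f₁ := hf.indicator (hs1 t)
    have hf₂m : Measurable f₂ := hf.indicator (hs2 t)
    have hf₁i : Integrable f₁ μ := hfi.indicator (hs1 t)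
    have hf₂i : Integrable f₂ μ := hfi.indicator (hs2 t)
    have hf₂b : ∀ x, |f₂ x| ≤ t / γ := fun x => by
      by_cases hx : γ * |f x| < t
      · rw [hf₂, indicator_of_mem (show x ∈ {x | γ * |f x| < t} from hx), le_div_iff₀ hγ0]
        linarith
      · rw [hf₂, indicator_of_notMem (show x ∉ {x | γ * |f x| < t} from hx), abs_zero]
        positivity
    have hsum : f = fun x => f₁ x + f₂ x := by
      ext x
      by_cases hx : γ * |f x| < t
      · simp [hf₁, hf₂, hx, not_le.2 hx]
      · simp [hf₁, hf₂, hx, not_lt.1 hx]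
    have hT : ∀ x, kernelOp k μ f x = kernelOp k μ f₁ x + kernelOp k μ f₂ x := fun x => by
      conv_lhs => rw [hsum]
      exact hk.kernelOp_add hε hf₁i hf₂i x
    have hsub : {x | t < |kernelOp k μ f x|} ⊆
        {x | t / 2 < |kernelOp k μ f₁ x|} ∪ {x | t / 2 < |kernelOp k μ f₂ x|} := by
      intro x hx
      by_contra hcon
      have hx : t < |kernelOp k μ f x| := hx
      simp only [mem_union, mem_ofPred_eq, not_or, not_lt] at hcon
      rw [hT] at hx
      linarith [abs_add_le (kernelOp k μ f₁ x) (kernelOp k μ f₂ x)]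
    have hreal : μ.real {x | t < |kernelOp k μ f x|} * t ≤
        ∫ x, 2 * W * |f₁ x| ∂μ + ∫ x, 4608 * a * W * |f₂ x| ^ 3 / t ^ 2 ∂μ := by
      rw [integral_const_mul, integral_div, integral_const_mul]
      have h1 := hw f₁ hf₁m hf₁i (t / 2) (half_pos ht)
      have h2 := measureReal_lt_abs_kernelOp_le hk hε hW ha hw hs hf₂m hf₂b (half_pos ht)
      have h3 := mul_le_mul_of_nonneg_right ((measureReal_mono hsub).trans
        ((measureReal_union_le _ _).trans (add_le_add h1 h2))) ht.le
      refine h3.trans (le_of_eq ?_)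
      field_simp
      ring
    have hf₂3 : Integrable (fun x => |f₂ x| ^ 3) μ := integrable_of_abs_le
      (hf₂m.abs.pow_const 3) (C := (t / γ) ^ 3) fun x => by
        rw [abs_pow, abs_abs]; gcongr; exact hf₂b x
    calc μ {x | t < |kernelOp k μ f x|} * ENNReal.ofReal (t ^ (2 - 1 : ℝ))
        = ENNReal.ofReal (μ.real {x | t < |kernelOp k μ f x|} * t) := by
          rw [ENNReal.ofReal_mul measureReal_nonneg, ofReal_measureReal]
          norm_num
      _ ≤ _ := ENNReal.ofReal_le_ofReal hreal
      _ = ∫⁻ x, ENNReal.ofReal (2 * W * |f₁ x|) ∂μ +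
          ∫⁻ x, ENNReal.ofReal (4608 * a * W * |f₂ x| ^ 3 / t ^ 2) ∂μ := by
          rw [ENNReal.ofReal_add (integral_nonneg fun x => by positivity)
            (integral_nonneg fun x => by positivity),
            ofReal_integral_eq_lintegral_ofReal (hf₁i.abs.const_mul _)
              (ae_of_all _ fun x => by positivity),
            ofReal_integral_eq_lintegral_ofReal ((hf₂3.const_mul _).div_const _)
              (ae_of_all _ fun x => by positivity)]
      _ = _ := by
          congr 1
          · refine lintegral_congr fun x => ?_
            by_cases hx : t ≤ γ * |f x| <;> simp [hf₁, hx]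
          · refine lintegral_congr fun x => ?_
            by_cases hx : γ * |f x| < t <;> simp [hf₂, hx]
  have hm1 : Measurable fun p : ℝ × E => {x | p.1 ≤ γ * |f x|}.indicator
      (fun x => ENNReal.ofReal (2 * W * |f x|)) p.2 := by
    have : Measurable fun p : ℝ × E => ENNReal.ofReal (2 * W * |f p.2|) := by fun_prop
    exact this.indicator (measurableSet_le measurable_fst
      ((hf.comp measurable_snd).abs.const_mul γ))
  have hm2 : Measurable fun p : ℝ × E => {x | γ * |f x| < p.1}.indicator
      (fun x => ENNReal.ofReal (4608 * a * W * |f x| ^ 3 / p.1 ^ 2)) p.2 := by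
    have : Measurable fun p : ℝ × E =>
      ENNReal.ofReal (4608 * a * W * |f p.2| ^ 3 / p.1 ^ 2) := by fun_prop
    exact this.indicator (measurableSet_lt ((hf.comp measurable_snd).abs.const_mul γ)
      measurable_fst)
  have hI1 : ∫⁻ t in Ioi (0 : ℝ), ∫⁻ x, {x | t ≤ γ * |f x|}.indicator
      (fun x => ENNReal.ofReal (2 * W * |f x|)) x ∂μ = 
      ENNReal.ofReal (2 * W * γ) * ∫⁻ x, ENNReal.ofReal (f x ^ 2) ∂μ := by
    rw [lintegral_lintegral_swap hm1.aemeasurable, ← lintegral_const_mul _ (by fun_prop)]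
    refine lintegral_congr fun x => ?_
    have : ∀ t, {x | t ≤ γ * |f x|}.indicator (fun x => ENNReal.ofReal (2 * W * |f x|)) x =
        (Iic (γ * |f x|)).indicator (fun _ => ENNReal.ofReal (2 * W * |f x|)) t := fun t => by
      by_cases ht : t ≤ γ * |f x| <;> simp [ht]
    simp only [this]
    rw [setLIntegral_indicator measurableSet_Iic, setLIntegral_const, inter_comm, Ioi_inter_Iic,
      Real.volume_Ioc, sub_zero, ← ENNReal.ofReal_mul (by positivity),
      ← ENNReal.ofReal_mul (by positivity), ← sq_abs (f x)]
    congr 1; ring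
  have hI2 : ∫⁻ t in Ioi (0 : ℝ), ∫⁻ x, {x | γ * |f x| < t}.indicator
        (fun x => ENNReal.ofReal (4608 * a * W * |f x| ^ 3 / t ^ 2)) x ∂μ =
      ENNReal.ofReal (a / 4) * ∫⁻ x, ENNReal.ofReal (f x ^ 2) ∂μ := by
    rw [lintegral_lintegral_swap hm2.aemeasurable, ← lintegral_const_mul _ (by fun_prop)]
    refine lintegral_congr fun x => ?_
    rcases eq_or_ne (f x) 0 with h0 | h0
    · simp [h0, indicator]
    have hpos : 0 < γ * |f x| := mul_pos hγ0 (abs_pos.2 h0)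
    have : ∀ t, {x | γ * |f x| < t}.indicator
        (fun x => ENNReal.ofReal (4608 * a * W * |f x| ^ 3 / t ^ 2)) x =
        (Ioi (γ * |f x|)).indicator
          (fun t => ENNReal.ofReal (4608 * a * W * |f x| ^ 3 / t ^ 2)) t := fun t => by
      by_cases ht : γ * |f x| < t <;> simp [ht]
    simp only [this]
    rw [setLIntegral_indicator measurableSet_Ioi,
      inter_eq_left.2 (Ioi_subset_Ioi hpos.le), lintegral_Ioi_div_sq (by positivity) hpos,
      ← ENNReal.ofReal_mul (by positivity), ← sq_abs (f x)]
    have := abs_pos.2 h0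
    congr 1
    rw [hγ]; field_simp; norm_num
  have hlint : ∫⁻ x, ENNReal.ofReal (kernelOp k μ f x ^ 2) ∂μ ≤
      ENNReal.ofReal (a / 2 + 73728 * W ^ 2) * ∫⁻ x, ENNReal.ofReal (f x ^ 2) ∂μ := by
    have := lintegral_rpow_eq_lintegral_meas_lt_mul μ (f := fun x => |kernelOp k μ f x|)
      (ae_of_all _ fun x => abs_nonneg _) hTm.abs.aemeasurable (p := 2) (by norm_num)
    simp only [Real.rpow_two, sq_abs] at this
    rw [this]
    calc _ ≤ ENNReal.ofReal 2 * ∫⁻ t in Ioi (0 : ℝ),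
          (∫⁻ x, {x | t ≤ γ * |f x|}.indicator (fun x => ENNReal.ofReal (2 * W * |f x|)) x ∂μ +
          ∫⁻ x, {x | γ * |f x| < t}.indicator
            (fun x => ENNReal.ofReal (4608 * a * W * |f x| ^ 3 / t ^ 2)) x ∂μ) := by
          gcongr ?_ * ?_
          · rfl
          exact setLIntegral_mono_ae (by fun_prop) (ae_of_all _ hlevel)
      _ = _ := by
          rw [lintegral_add_left hm1.lintegral_prod_right', hI1, hI2, ← add_mul, ← mul_assoc,
            ← ENNReal.ofReal_add (by positivity) (by positivity),
            ← ENNReal.ofReal_mul (by norm_num)]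
          congr 2
          rw [hγ]; ring
  rw [integral_eq_lintegral_of_nonneg_ae (ae_of_all _ fun x => sq_nonneg _)
    (hTm.pow_const 2).aestronglyMeasurable]
  refine ENNReal.toReal_le_of_le_ofReal (by positivity) ?_
  rwa [ENNReal.ofReal_mul (by positivity), ofReal_integral_eq_lintegral_ofReal hf2
    (ae_of_all _ fun x => sq_nonneg _)]

/-- Crude `L²` bound, depending on the regularization. -/
lemma OddCZKernel.exists_strongTwoTwo (hk : OddCZKernel n ε L k) (hε : 0 < ε) :
    ∃ a, 0 < a ∧ StrongTwoTwo k μ a := by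
  refine ⟨((ε ^ n)⁻¹) ^ 2 * μ.real univ ^ 2 + 1, by positivity, fun f hf hf2 => ?_⟩
  have hfi := integrable_of_integrable_sq hf hf2
  have hb := hk.abs_kernelOp_le (μ := μ) hε hfi
  have hcs := sq_integral_abs_le hf hf2
  have hf20 : 0 ≤ ∫ x, f x ^ 2 ∂μ := integral_nonneg fun x => sq_nonneg _
  set J := (ε ^ n)⁻¹ * ∫ x, |f x| ∂μ with hJ
  calc ∫ x, kernelOp k μ f x ^ 2 ∂μ ≤ ∫ _, J ^ 2 ∂μ :=
        integral_mono (integrable_of_abs_le ((hk.measurable_kernelOp hf).pow_const 2)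
          (C := J ^ 2) fun x => by rw [abs_pow]; gcongr; exact hb x) (integrable_const _)
          fun x => by simp only; rw [← sq_abs]; gcongr; exact hb x
    _ = μ.real univ * (((ε ^ n)⁻¹) ^ 2 * (∫ x, |f x| ∂μ) ^ 2) := by
        rw [integral_const, smul_eq_mul, hJ]; ring
    _ ≤ μ.real univ * (((ε ^ n)⁻¹) ^ 2 * (μ.real univ * ∫ x, f x ^ 2 ∂μ)) := by gcongr
    _ ≤ _ := by nlinarith

/-- Weak type `(1,1)` implies `L²` boundedness for operators with odd kernel. -/
lemma WeakOneOne.strongTwoTwo (hk : OddCZKernel n ε L k) (hε : 0 < ε) {W : ℝ} (hW : 0 < W)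
    (hw : WeakOneOne k μ W) : StrongTwoTwo k μ (150000 * W ^ 2) := by
  obtain ⟨a, ha, hs⟩ := hk.exists_strongTwoTwo (μ := μ) hε
  have hiter : ∀ m : ℕ, StrongTwoTwo k μ (a / 2 ^ m + 147456 * W ^ 2) := by
    intro m
    induction m with
    | zero =>
      intro f hf hf2
      refine (hs f hf hf2).trans ?_
      have : 0 ≤ ∫ x, f x ^ 2 ∂μ := integral_nonneg fun x => sq_nonneg _
      gcongr
      simp only [pow_zero, div_one]
      nlinarith [sq_nonneg W]
    | succ m ih =>
      have := StrongTwoTwo.improve hk hε hW (by positivity) hw ih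
      convert this using 1
      rw [pow_succ]; field_simp; ring
  obtain ⟨m, hm⟩ := pow_unbounded_of_one_lt (a / (2544 * W ^ 2)) (one_lt_two)
  intro f hf hf2
  refine (hiter m f hf hf2).trans ?_
  have : 0 ≤ ∫ x, f x ^ 2 ∂μ := integral_nonneg fun x => sq_nonneg _
  gcongr
  have h1 : a / 2 ^ m ≤ 2544 * W ^ 2 := by
    rw [div_lt_iff₀ (by positivity)] at hm
    rw [div_le_iff₀ (by positivity)]
    linarith
  linarith

end Strong

section Sum
variable {E : Type*} [NormedAddCommGroup E] {n : ℕ} {ε L c A : ℝ} {k : E → ℝ}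

lemma OddCZKernel.neg (hk : OddCZKernel n ε L k) : OddCZKernel n ε L fun z => -k z where
  continuous := hk.continuous.neg
  odd z := by rw [hk.odd]
  size z := by rw [abs_neg]; exact hk.size z
  smooth z w h := by
    rw [← neg_sub_neg, neg_neg, neg_neg, abs_sub_comm, ← abs_neg, neg_sub]
    rw [abs_sub_comm]
    exact hk.smooth z w h

variable [MeasurableSpace E] [BorelSpace E] [SecondCountableTopology E] {μ σ : Measure E}
  [IsFiniteMeasure μ] [IsFiniteMeasure σ]

lemma measureReal_lt_abs_integral_kernel_le {ν : Measure E} [IsFiniteMeasure ν]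
    (hk : OddCZKernel n ε L k) (hε : 0 < ε) (hL : 0 ≤ L) (hc : 0 ≤ c) (hA : 0 ≤ A)
    (hμ : ∀ (x : E) (r : ℝ), 0 < r → μ.real (closedBall x r) ≤ c * r ^ n)
    (hT : ∀ u : E → ℝ, Measurable u → (∀ y, |u y| ≤ 1) →
      ∫ x, kernelOp k μ u x ^ 2 ∂μ ≤ A * ∫ x, u x ^ 2 ∂μ)
    {N : ℝ} (hN : 0 < N) (hμN : μ (closedBall 0 N)ᶜ = 0) (hνN : ν (closedBall 0 N)ᶜ = 0)
    {l : ℝ} (hl : 0 < l) :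
    μ.real {x | l < |∫ y, k (x - y) ∂ν|} ≤ 2 * weakConst n L c A / l * ν.real univ := by
  have h1 := measureReal_lt_integral_kernel_le hk hε hL hc hA hμ hT hN hμN hνN hl
  have h2 := measureReal_lt_integral_kernel_le hk.neg hε hL hc hA hμ
    (fun u hu hu1 => by simpa [kernelOp, integral_neg] using hT u hu hu1) hN hμN hνN hl
  simp only [integral_neg] at h2
  have hsub : {x | l < |∫ y, k (x - y) ∂ν|} ⊆
      {x | l < ∫ y, k (x - y) ∂ν} ∪ {x | l < - ∫ y, k (x - y) ∂ν} := fun x hx => by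
    have hx' : l < |∫ y, k (x - y) ∂ν| := hx
    exact lt_abs.1 hx'
  refine (measureReal_mono hsub).trans ((measureReal_union_le _ _).trans
    ((add_le_add h1 h2).trans (le_of_eq ?_)))
  ring

lemma measureReal_lt_abs_kernelOp_le_integral {ω : Measure E} [IsFiniteMeasure ω]
    (hk : OddCZKernel n ε L k) (hε : 0 < ε) (hL : 0 ≤ L) (hc : 0 ≤ c) (hA : 0 ≤ A)
    (hμ : ∀ (x : E) (r : ℝ), 0 < r → μ.real (closedBall x r) ≤ c * r ^ n)
    (hT : ∀ u : E → ℝ, Measurable u → (∀ y, |u y| ≤ 1) →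
      ∫ x, kernelOp k μ u x ^ 2 ∂μ ≤ A * ∫ x, u x ^ 2 ∂μ)
    {N : ℝ} (hN : 0 < N) (hμN : μ (closedBall 0 N)ᶜ = 0) (hωN : ω (closedBall 0 N)ᶜ = 0)
    {f : E → ℝ} (hf : Measurable f) (hfi : Integrable f ω) {l : ℝ} (hl : 0 < l) :
    μ.real {x | l < |kernelOp k ω f x|} ≤ 4 * weakConst n L c A / l * ∫ x, |f x| ∂ω := by
  have key : ∀ g : E → ℝ, Measurable g → Integrable g ω →
      μ.real {x | l / 2 < |∫ y, k (x - y) * max (g y) 0 ∂ω|} ≤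
        4 * weakConst n L c A / l * ∫ y, max (g y) 0 ∂ω := by
    intro g hg hgi
    set ν := ω.withDensity fun y => ((g y).toNNReal : ℝ≥0∞) with hν
    have hfin : IsFiniteMeasure ν := isFiniteMeasure_withDensity_ofReal hgi.2
    have hint : ∀ h : E → ℝ, ∫ y, h y ∂ν = ∫ y, h y * max (g y) 0 ∂ω := fun h => by
      rw [hν, integral_withDensity_eq_integral_smul hg.real_toNNReal]
      refine integral_congr_ae (ae_of_all _ fun y => ?_)
      simp only [NNReal.smul_def, Real.coe_toNNReal', smul_eq_mul, mul_comm]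
    have h1 := measureReal_lt_abs_integral_kernel_le (ν := ν) hk hε hL hc hA hμ hT hN hμN
      (withDensity_absolutelyContinuous _ _ hωN) (half_pos hl)
    have h2 : ν.real univ = ∫ y, max (g y) 0 ∂ω := by
      have := hint fun _ => 1
      simpa using this
    simp only [hint] at h1
    rw [h2] at h1
    refine h1.trans (le_of_eq ?_)
    field_simp; ring
  have hf0 : ∀ x, f x = max (f x) 0 - max (-f x) 0 := fun x => by
    rcases le_total 0 (f x) with h | h <;> simp [h]
  have hdec : ∀ x, kernelOp k ω f x =
      ∫ y, k (x - y) * max (f y) 0 ∂ω - ∫ y, k (x - y) * max (-f y) 0 ∂ω := fun x => by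
    rw [← integral_sub (hk.integrable_mul hε hfi.pos_part x)
      (hk.integrable_mul hε hfi.neg_part x)]
    refine integral_congr_ae (ae_of_all _ fun y => ?_)
    simp only
    rw [← mul_sub, ← hf0]
  have hsub : {x | l < |kernelOp k ω f x|} ⊆
      {x | l / 2 < |∫ y, k (x - y) * max (f y) 0 ∂ω|} ∪
      {x | l / 2 < |∫ y, k (x - y) * max (-f y) 0 ∂ω|} := by
    intro x hx
    have hx' : l < |kernelOp k ω f x| := hx
    by_contra hcon
    simp only [mem_union, mem_ofPred_eq, not_or, not_lt] at hcon
    rw [hdec] at hx'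
    linarith [abs_sub (∫ y, k (x - y) * max (f y) 0 ∂ω) (∫ y, k (x - y) * max (-f y) 0 ∂ω)]
  refine (measureReal_mono hsub).trans ((measureReal_union_le _ _).trans
    ((add_le_add (key f hf hfi) (key _ hf.neg hfi.neg)).trans (le_of_eq ?_)))
  rw [← mul_add]
  congr 1
  refine (integral_add hfi.pos_part hfi.neg_part).symm.trans ?_
  refine integral_congr_ae (ae_of_all _ fun y => ?_)
  simp only
  rcases le_total 0 (f y) with h | h <;> simp [h, abs_of_nonneg, abs_of_nonpos]

/-- If an operator with an odd kernel is bounded in `L²(μ)` and in `L²(σ)`, then it is bounded in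
`L²(μ + σ)`, with a bound independent of the regularization. -/
lemma OddCZKernel.strongTwoTwo_add (hk : OddCZKernel n ε L k) (hε : 0 < ε) (hL : 0 ≤ L)
    (hc : 0 ≤ c) (hA : 0 ≤ A)
    (hμ : ∀ (x : E) (r : ℝ), 0 < r → μ.real (closedBall x r) ≤ c * r ^ n)
    (hσ : ∀ (x : E) (r : ℝ), 0 < r → σ.real (closedBall x r) ≤ c * r ^ n)
    (hTμ : ∀ u : E → ℝ, Measurable u → (∀ y, |u y| ≤ 1) →
      ∫ x, kernelOp k μ u x ^ 2 ∂μ ≤ A * ∫ x, u x ^ 2 ∂μ)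
    (hTσ : ∀ u : E → ℝ, Measurable u → (∀ y, |u y| ≤ 1) →
      ∫ x, kernelOp k σ u x ^ 2 ∂σ ≤ A * ∫ x, u x ^ 2 ∂σ)
    {N : ℝ} (hN : 0 < N) (hμN : μ (closedBall 0 N)ᶜ = 0) (hσN : σ (closedBall 0 N)ᶜ = 0) :
    StrongTwoTwo k (μ + σ) (150000 * (8 * weakConst n L c A) ^ 2) := by
  have hW := weakConst_pos (n := n) hL hc hA
  have hωN : (μ + σ) (closedBall 0 N)ᶜ = 0 := by simp [hμN, hσN]
  refine WeakOneOne.strongTwoTwo hk hε (by linarith) fun f hf hfi l hl => ?_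
  have h1 := measureReal_lt_abs_kernelOp_le_integral hk hε hL hc hA hμ hTμ hN hμN hωN hf hfi hl
  have h2 := measureReal_lt_abs_kernelOp_le_integral hk hε hL hc hA hσ hTσ hN hσN hωN hf hfi hl
  rw [measureReal_add_apply]
  refine (add_le_add h1 h2).trans (le_of_eq ?_)
  ring

end Sum

/-- The coordinates of the regularized Riesz kernel. -/
def rieszKernel (n : ℕ) (ε : ℝ) {d : ℕ} (i : Fin d) (z : Euc d) : ℝ :=
  ((max ‖z‖ ε) ^ (n + 1))⁻¹ * z i

lemma oddCZKernel_rieszKernel (n : ℕ) {ε : ℝ} (hε : 0 < ε) {d : ℕ} (i : Fin d) :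
    OddCZKernel n ε (1 + (n + 1) * 4 ^ n) (rieszKernel n ε i) := by
  have hm : ∀ z : Euc d, 0 < max ‖z‖ ε := fun z => lt_max_of_lt_right hε
  have hi : ∀ z : Euc d, |z i| ≤ ‖z‖ := fun z => PiLp.norm_apply_le z i
  refine ⟨?_, fun z => ?_, fun z => ?_, fun z w h => ?_⟩
  · unfold rieszKernel
    exact (((continuous_norm.max continuous_const).pow _).inv₀ fun z => (pow_pos (hm z) _).ne').mul
      (by fun_prop)
  · simp [rieszKernel]
  · rw [rieszKernel, abs_mul, abs_of_pos (inv_pos.2 (pow_pos (hm z) _)), pow_succ, mul_inv,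
      mul_assoc]
    refine mul_le_of_le_one_right (inv_nonneg.2 (pow_nonneg (hm z).le _)) ?_
    rw [inv_mul_le_one₀ (hm z)]
    exact (hi z).trans (le_max_left _ _)
  · rcases eq_or_ne z 0 with rfl | hz
    · have : w = 0 := by simpa using h
      simp [this]
    have hz0 : 0 < ‖z‖ := norm_pos_iff.2 hz
    set a := max ‖z‖ ε with ha
    set b := max ‖w‖ ε with hb
    set δ := ‖z - w‖ with hδ
    have ha0 : 0 < a := hm z
    have hb0 : 0 < b := hm w
    have hδ0 : 0 ≤ δ := norm_nonneg _
    have hza : ‖z‖ ≤ a := le_max_left _ _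
    have hab : |a - b| ≤ δ := (abs_max_sub_max_le_abs _ _ _).trans (abs_norm_sub_norm_le z w)
    have hb2 : b ≤ 2 * a := by linarith [(abs_le.1 hab).1]
    have ha2 : a ≤ 2 * b := by
      have h1 : ‖z‖ ≤ 2 * ‖w‖ := by linarith [norm_sub_norm_le z w]
      exact max_le (h1.trans (by linarith [le_max_left ‖w‖ ε])) (by linarith [le_max_right ‖w‖ ε])
    have hpow : |a ^ (n + 1) - b ^ (n + 1)| ≤ δ * (n + 1) * (2 * a) ^ n := by
      refine (abs_pow_sub_pow_le a b (n + 1)).trans ?_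
      rw [abs_of_pos ha0, abs_of_pos hb0, Nat.add_sub_cancel]
      push_cast
      gcongr
      exact max_le (by linarith) hb2
    have hdec : rieszKernel n ε i z - rieszKernel n ε i w =
        (a ^ (n + 1))⁻¹ * (z i - w i) -
          (a ^ (n + 1) - b ^ (n + 1)) * ((a ^ (n + 1))⁻¹ * ((b ^ (n + 1))⁻¹ * w i)) := by
      simp only [rieszKernel, ← ha, ← hb]
      field_simp
      ring
    have hfirst : |(a ^ (n + 1))⁻¹ * (z i - w i)| ≤ δ * (a ^ (n + 1))⁻¹ := by
      rw [abs_mul, abs_of_pos (by positivity), mul_comm]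
      gcongr
      exact hi (z - w)
    have hw : |(b ^ (n + 1))⁻¹ * w i| ≤ (b ^ n)⁻¹ := by
      rw [abs_mul, abs_of_pos (by positivity), pow_succ, mul_inv, mul_assoc]
      refine mul_le_of_le_one_right (by positivity) ?_
      rw [inv_mul_le_one₀ hb0]
      exact (hi w).trans (le_max_left _ _)
    have hsecond : |(a ^ (n + 1) - b ^ (n + 1)) * ((a ^ (n + 1))⁻¹ * ((b ^ (n + 1))⁻¹ * w i))| ≤
        (n + 1) * 4 ^ n * δ * (a ^ (n + 1))⁻¹ := by
      have hbn : (b ^ n)⁻¹ ≤ ((a / 2) ^ n)⁻¹ := by gcongr; linarith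
      calc _ ≤ (δ * (n + 1) * (2 * a) ^ n) * ((a ^ (n + 1))⁻¹ * ((a / 2) ^ n)⁻¹) := by
            rw [abs_mul, abs_mul (a ^ (n + 1))⁻¹, abs_of_pos (inv_pos.2 (pow_pos ha0 (n + 1)))]
            gcongr
            exact hw.trans hbn
        _ = _ := by
            have : (4 : ℝ) ^ n = 2 ^ n * 2 ^ n := by rw [← mul_pow]; norm_num
            rw [mul_pow, div_pow, this]
            field_simp
    calc |rieszKernel n ε i z - rieszKernel n ε i w|
        ≤ δ * (a ^ (n + 1))⁻¹ + (n + 1) * 4 ^ n * δ * (a ^ (n + 1))⁻¹ := by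
          rw [hdec]; exact (abs_sub _ _).trans (add_le_add hfirst hsecond)
      _ = (1 + (n + 1) * 4 ^ n) * δ * (a ^ (n + 1))⁻¹ := by ring
      _ ≤ _ := by gcongr

section LocalAverage
variable {E : Type*} [NormedAddCommGroup E] {n : ℕ} {ε c : ℝ}
variable [MeasurableSpace E] [BorelSpace E] [SecondCountableTopology E] {ν : Measure E}
  [IsFiniteMeasure ν]

/-- The local averages at scale `ε`. -/
def localAvg (n : ℕ) (ε : ℝ) (ν : Measure E) (f : E → ℝ) (x : E) : ℝ :=
  (ε ^ n)⁻¹ * ∫ y in closedBall x ε, |f y| ∂ν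

lemma measurableSet_dist_le (ε : ℝ) : MeasurableSet {p : E × E | dist p.2 p.1 ≤ ε} :=
  measurableSet_le (by fun_prop) measurable_const

lemma measurable_localAvg {f : E → ℝ} (hf : Measurable f) : Measurable (localAvg n ε ν f) := by
  have h : StronglyMeasurable (Function.uncurry fun x y : E => (closedBall x ε).indicator
      (fun y => |f y|) y) :=
    (((hf.comp measurable_snd).abs).indicator (measurableSet_dist_le ε)).stronglyMeasurable
  have h2 := h.integral_prod_right (ν := ν)
  simp only [integral_indicator measurableSet_closedBall] at h2
  exact h2.measurable.const_mul _

lemma lintegral_localAvg_sq_le (hε : 0 < ε) (hc : 0 ≤ c)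
    (hν : ∀ (x : E) (r : ℝ), 0 < r → ν.real (closedBall x r) ≤ c * r ^ n) {f : E → ℝ}
    (hf : Measurable f) (hf2 : Integrable (fun x => f x ^ 2) ν) :
    ∫⁻ x, ENNReal.ofReal (localAvg n ε ν f x ^ 2) ∂ν ≤
      ENNReal.ofReal (c ^ 2) * ∫⁻ x, ENNReal.ofReal (f x ^ 2) ∂ν := by
  have hpt : ∀ x, ENNReal.ofReal (localAvg n ε ν f x ^ 2) ≤
      ∫⁻ y, (closedBall x ε).indicator (fun y => ENNReal.ofReal (c / ε ^ n * f y ^ 2)) y ∂ν := by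
    intro x
    rw [lintegral_indicator measurableSet_closedBall, ← ofReal_integral_eq_lintegral_ofReal
      (hf2.integrableOn.const_mul _) (ae_of_all _ fun y => by positivity), integral_const_mul]
    refine ENNReal.ofReal_le_ofReal ?_
    have h1 := sq_integral_abs_le (μ := ν.restrict (closedBall x ε)) hf hf2.integrableOn
    rw [measureReal_restrict_apply_univ] at h1
    have h0 : 0 ≤ ∫ y in closedBall x ε, f y ^ 2 ∂ν := integral_nonneg fun y => sq_nonneg _
    have h2 : (∫ y in closedBall x ε, |f y| ∂ν) ^ 2 ≤
        c * ε ^ n * ∫ y in closedBall x ε, f y ^ 2 ∂ν :=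
      h1.trans (by gcongr; exact hν x ε hε)
    rw [localAvg, mul_pow]
    calc _ ≤ ((ε ^ n)⁻¹) ^ 2 * (c * ε ^ n * ∫ y in closedBall x ε, f y ^ 2 ∂ν) := by gcongr
      _ = _ := by field_simp
  have hm : Measurable fun p : E × E => (closedBall p.1 ε).indicator
      (fun y => ENNReal.ofReal (c / ε ^ n * f y ^ 2)) p.2 := by
    have : Measurable fun p : E × E => ENNReal.ofReal (c / ε ^ n * f p.2 ^ 2) := by fun_prop
    exact this.indicator (measurableSet_dist_le ε)
  refine (lintegral_mono hpt).trans ?_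
  rw [lintegral_lintegral_swap hm.aemeasurable, ← lintegral_const_mul _ (by fun_prop)]
  refine lintegral_mono fun y => ?_
  have : ∀ x, (closedBall x ε).indicator (fun y => ENNReal.ofReal (c / ε ^ n * f y ^ 2)) y =
      (closedBall y ε).indicator (fun _ => ENNReal.ofReal (c / ε ^ n * f y ^ 2)) x := fun x => by
    by_cases h : dist x y ≤ ε
    · simp [h, dist_comm y x]
    · simp [h, dist_comm y x]
  simp only [this]
  rw [lintegral_indicator measurableSet_closedBall, setLIntegral_const, ← ofReal_measureReal,
    ← ENNReal.ofReal_mul (by positivity), ← ENNReal.ofReal_mul (by positivity)]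
  refine ENNReal.ofReal_le_ofReal ?_
  calc _ ≤ c / ε ^ n * f y ^ 2 * (c * ε ^ n) := by gcongr; exact hν y ε hε
    _ = _ := by field_simp

end LocalAverage

section Trunc
variable {d n : ℕ} {ε : ℝ} {ν : Measure (Euc d)} {f : Euc d → ℝ}

lemma measurableSet_lt_norm_sub (ε : ℝ) (x : Euc d) : MeasurableSet {y : Euc d | ε < ‖x - y‖} :=
  measurableSet_lt measurable_const (by fun_prop)

lemma truncRiesz_apply (hε : 0 < ε) (hf : Measurable f) (hfi : Integrable f ν) (i : Fin d)
    (x : Euc d) :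
    truncRiesz n ν ε f x i = ∫ y in {y | ε < ‖x - y‖}, rieszKernel n ε i (x - y) * f y ∂ν := by
  have hint : IntegrableOn (fun y => (‖x - y‖ ^ (n + 1))⁻¹ • f y • (x - y))
      {y | ε < ‖x - y‖} ν := by
    refine Integrable.mono' ((hfi.abs.const_mul (ε ^ n)⁻¹).integrableOn)
      (by fun_prop)
      ((ae_restrict_iff' (measurableSet_lt_norm_sub ε x)).2 (ae_of_all _ fun y hy => ?_))
    have hy' : ε < ‖x - y‖ := hy
    have hpos : 0 < ‖x - y‖ := hε.trans hy'
    rw [norm_smul, norm_smul, Real.norm_eq_abs, Real.norm_eq_abs, abs_of_pos (by positivity)]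
    calc (‖x - y‖ ^ (n + 1))⁻¹ * (|f y| * ‖x - y‖) = (‖x - y‖ ^ n)⁻¹ * |f y| := by
          field_simp
          ring
      _ ≤ _ := by gcongr
  have h := (EuclideanSpace.proj (𝕜 := ℝ) i).integral_comp_comm hint
  rw [truncRiesz]
  refine h.symm.trans (setIntegral_congr_fun (measurableSet_lt_norm_sub ε x) fun y hy => ?_)
  have hy' : ε < ‖x - y‖ := hy
  simp only [rieszKernel, max_eq_left hy'.le]
  change (‖x - y‖ ^ (n + 1))⁻¹ * (f y * (x - y) i) = _
  ring

lemma abs_kernelOp_sub_truncRiesz_le (hε : 0 < ε) (hf : Measurable f) (hfi : Integrable f ν)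
    (i : Fin d) (x : Euc d) :
    |kernelOp (rieszKernel n ε i) ν f x - truncRiesz n ν ε f x i| ≤ localAvg n ε ν f x := by
  have hk := oddCZKernel_rieszKernel n hε i
  have hint := hk.integrable_mul hε hfi x
  have hcompl : {y : Euc d | ε < ‖x - y‖}ᶜ = closedBall x ε := by
    ext y; simp [dist_eq_norm, norm_sub_rev x y]
  rw [truncRiesz_apply hε hf hfi, kernelOp,
    ← integral_add_compl (measurableSet_lt_norm_sub ε x) hint, add_sub_cancel_left, hcompl,
    localAvg, ← integral_const_mul]
  refine abs_integral_le_integral_abs.trans (integral_mono hint.integrableOn.abs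
    (hfi.abs.const_mul _).integrableOn fun y => ?_)
  simp only [abs_mul]
  gcongr
  exact hk.abs_le hε _

variable [IsFiniteMeasure ν]

lemma measurable_truncRiesz (hf : Measurable f) : Measurable (truncRiesz n ν ε f) := by
  have hm : Measurable fun p : Euc d × Euc d =>
      (‖p.1 - p.2‖ ^ (n + 1))⁻¹ • f p.2 • (p.1 - p.2) := by fun_prop
  have h : StronglyMeasurable (Function.uncurry fun x y : Euc d =>
      {y : Euc d | ε < ‖x - y‖}.indicator
        (fun y => (‖x - y‖ ^ (n + 1))⁻¹ • f y • (x - y)) y) :=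
    (hm.indicator (s := {p : Euc d × Euc d | ε < ‖p.1 - p.2‖})
      (measurableSet_lt measurable_const (by fun_prop))).stronglyMeasurable
  have h2 := h.integral_prod_right (ν := ν)
  simp only [integral_indicator (measurableSet_lt_norm_sub _ _)] at h2
  exact h2.measurable

end Trunc

lemma coe_nnnorm_sq_eq_ofReal {F : Type*} [SeminormedAddCommGroup F] (v : F) :
    (‖v‖₊ : ℝ≥0∞) ^ 2 = ENNReal.ofReal (‖v‖ ^ 2) := by
  rw [ENNReal.ofReal_pow (norm_nonneg v), ofReal_norm]; rfl

lemma coe_nnnorm_real_sq_eq_ofReal (a : ℝ) : (‖a‖₊ : ℝ≥0∞) ^ 2 = ENNReal.ofReal (a ^ 2) := by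
  rw [coe_nnnorm_sq_eq_ofReal, Real.norm_eq_abs, sq_abs]

lemma ofReal_sq_le_of_abs_sub_le {a b g : ℝ} (h : |a - b| ≤ g) :
    ENNReal.ofReal (a ^ 2) ≤ 2 * ENNReal.ofReal (b ^ 2) + 2 * ENNReal.ofReal (g ^ 2) := by
  have e2 : (2 : ℝ≥0∞) = ENNReal.ofReal 2 := by simp
  rw [e2, ← ENNReal.ofReal_mul (by norm_num), ← ENNReal.ofReal_mul (by norm_num),
    ← ENNReal.ofReal_add (by positivity) (by positivity)]
  refine ENNReal.ofReal_le_ofReal ?_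
  have h2 : (a - b) ^ 2 ≤ g ^ 2 := by
    rw [← sq_abs (a - b)]; gcongr
  nlinarith [sq_nonneg (a - 2 * b)]

section Assembly
variable {d n : ℕ} {ε c C : ℝ}

lemma truncRiesz_restrict {μ : Measure (Euc d)} {B : Set (Euc d)} (hB : MeasurableSet B)
    (f : Euc d → ℝ) (x : Euc d) :
    truncRiesz n (μ.restrict B) ε f x = truncRiesz n μ ε (B.indicator f) x := by
  rw [truncRiesz, truncRiesz, Measure.restrict_restrict (measurableSet_lt_norm_sub ε x),
    ← setIntegral_indicator hB]
  refine integral_congr_ae (ae_of_all _ fun y => ?_)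
  by_cases hy : y ∈ B <;> simp [hy]

lemma lintegral_truncRiesz_restrict_le {μ : Measure (Euc d)}
    (h : ∀ f : Euc d → ℝ, Measurable f → ∫⁻ x, (‖truncRiesz n μ ε f x‖₊ : ℝ≥0∞) ^ 2 ∂μ ≤
      ENNReal.ofReal C * ∫⁻ x, (‖f x‖₊ : ℝ≥0∞) ^ 2 ∂μ)
    {B : Set (Euc d)} (hB : MeasurableSet B) {f : Euc d → ℝ} (hf : Measurable f) :
    ∫⁻ x in B, (‖truncRiesz n (μ.restrict B) ε f x‖₊ : ℝ≥0∞) ^ 2 ∂μ ≤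
      ENNReal.ofReal C * ∫⁻ x in B, (‖f x‖₊ : ℝ≥0∞) ^ 2 ∂μ := by
  simp only [truncRiesz_restrict hB]
  refine (setLIntegral_le_lintegral _ _).trans ((h _ (hf.indicator hB)).trans (le_of_eq ?_))
  rw [← lintegral_indicator hB]
  congr 1
  refine lintegral_congr fun x => ?_
  by_cases hx : x ∈ B <;> simp [hx]

lemma integral_kernelOp_sq_le_of_truncRiesz {ν : Measure (Euc d)} [IsFiniteMeasure ν]
    (hε : 0 < ε) (hc : 0 ≤ c) (hC : 0 ≤ C)
    (hν : ∀ (x : Euc d) (r : ℝ), 0 < r → ν.real (closedBall x r) ≤ c * r ^ n) {f : Euc d → ℝ}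
    (hf : Measurable f) (hf2 : Integrable (fun x => f x ^ 2) ν)
    (h : ∫⁻ x, (‖truncRiesz n ν ε f x‖₊ : ℝ≥0∞) ^ 2 ∂ν ≤
      ENNReal.ofReal C * ∫⁻ x, (‖f x‖₊ : ℝ≥0∞) ^ 2 ∂ν) (i : Fin d) :
    ∫ x, kernelOp (rieszKernel n ε i) ν f x ^ 2 ∂ν ≤ 2 * (C + c ^ 2) * ∫ x, f x ^ 2 ∂ν := by
  have hfi := integrable_of_integrable_sq hf hf2
  have hKm := (oddCZKernel_rieszKernel n hε i).measurable_kernelOp (μ := ν) hf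
  have hJ0 : 0 ≤ ∫ x, f x ^ 2 ∂ν := integral_nonneg fun x => sq_nonneg _
  simp only [coe_nnnorm_real_sq_eq_ofReal] at h
  have hG := lintegral_localAvg_sq_le hε hc hν hf hf2
  have hpt : ∀ x, ENNReal.ofReal (kernelOp (rieszKernel n ε i) ν f x ^ 2) ≤
      2 * (‖truncRiesz n ν ε f x‖₊ : ℝ≥0∞) ^ 2 +
        2 * ENNReal.ofReal (localAvg n ε ν f x ^ 2) := fun x => by
    refine (ofReal_sq_le_of_abs_sub_le
      (abs_kernelOp_sub_truncRiesz_le hε hf hfi i x)).trans ?_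
    gcongr
    rw [coe_nnnorm_sq_eq_ofReal]
    refine ENNReal.ofReal_le_ofReal ?_
    rw [← sq_abs (truncRiesz n ν ε f x i)]
    gcongr
    exact PiLp.norm_apply_le (truncRiesz n ν ε f x) i
  have hGm : Measurable fun x => ENNReal.ofReal (localAvg n ε ν f x ^ 2) :=
    ((measurable_localAvg hf).pow_const 2).ennreal_ofReal
  rw [integral_eq_lintegral_of_nonneg_ae (ae_of_all _ fun x => sq_nonneg _)
    (hKm.pow_const 2).aestronglyMeasurable]
  refine ENNReal.toReal_le_of_le_ofReal (by positivity) ?_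
  calc _ ≤ ∫⁻ x, (2 * (‖truncRiesz n ν ε f x‖₊ : ℝ≥0∞) ^ 2 +
        2 * ENNReal.ofReal (localAvg n ε ν f x ^ 2)) ∂ν := lintegral_mono hpt
    _ = 2 * ∫⁻ x, (‖truncRiesz n ν ε f x‖₊ : ℝ≥0∞) ^ 2 ∂ν +
        2 * ∫⁻ x, ENNReal.ofReal (localAvg n ε ν f x ^ 2) ∂ν := by
      rw [lintegral_add_right _ (hGm.const_mul _), lintegral_const_mul' _ _ (by simp),
        lintegral_const_mul _ hGm]
    _ ≤ 2 * (ENNReal.ofReal C * ∫⁻ x, ENNReal.ofReal (f x ^ 2) ∂ν) +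
        2 * (ENNReal.ofReal (c ^ 2) * ∫⁻ x, ENNReal.ofReal (f x ^ 2) ∂ν) := by gcongr
    _ = _ := by
      rw [← ofReal_integral_eq_lintegral_ofReal hf2 (ae_of_all _ fun x => sq_nonneg _),
        ← mul_add, ← add_mul, ← ENNReal.ofReal_add hC (by positivity), ← mul_assoc,
        ENNReal.ofReal_mul (by positivity), ENNReal.ofReal_mul (by norm_num), ENNReal.ofReal_ofNat]

lemma lintegral_truncRiesz_sq_le {ν : Measure (Euc d)} [IsFiniteMeasure ν]
    (hε : 0 < ε) (hc : 0 ≤ c) {B : ℝ} (hB : 0 ≤ B)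
    (hν : ∀ (x : Euc d) (r : ℝ), 0 < r → ν.real (closedBall x r) ≤ c * r ^ n) {f : Euc d → ℝ}
    (hf : Measurable f) (hf2 : Integrable (fun x => f x ^ 2) ν)
    (h : ∀ i, ∫ x, kernelOp (rieszKernel n ε i) ν f x ^ 2 ∂ν ≤ B * ∫ x, f x ^ 2 ∂ν) :
    ∫⁻ x, (‖truncRiesz n ν ε f x‖₊ : ℝ≥0∞) ^ 2 ∂ν ≤
      ENNReal.ofReal (d * (2 * (B + c ^ 2))) * ∫⁻ x, (‖f x‖₊ : ℝ≥0∞) ^ 2 ∂ν := by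
  have hfi := integrable_of_integrable_sq hf hf2
  have hKm : ∀ i, Measurable (kernelOp (rieszKernel n ε i) ν f) := fun i =>
    (oddCZKernel_rieszKernel n hε i).measurable_kernelOp (μ := ν) hf
  have hGm : Measurable fun x => ENNReal.ofReal (localAvg n ε ν f x ^ 2) :=
    ((measurable_localAvg hf).pow_const 2).ennreal_ofReal
  have hG := lintegral_localAvg_sq_le hε hc hν hf hf2
  simp only [coe_nnnorm_real_sq_eq_ofReal]
  have hK : ∀ i, ∫⁻ x, ENNReal.ofReal (kernelOp (rieszKernel n ε i) ν f x ^ 2) ∂ν ≤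
      ENNReal.ofReal B * ∫⁻ x, ENNReal.ofReal (f x ^ 2) ∂ν := fun i => by
    have hk := oddCZKernel_rieszKernel n hε i
    have hb := hk.abs_kernelOp_le (μ := ν) hε hfi
    rw [← ofReal_integral_eq_lintegral_ofReal hf2 (ae_of_all _ fun x => sq_nonneg _),
      ← ofReal_integral_eq_lintegral_ofReal (integrable_of_abs_le ((hKm i).pow_const 2)
        (C := ((ε ^ n)⁻¹ * ∫ y, |f y| ∂ν) ^ 2) fun x => by
          rw [abs_pow]; gcongr; exact hb x) (ae_of_all _ fun x => sq_nonneg _),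
      ← ENNReal.ofReal_mul hB]
    exact ENNReal.ofReal_le_ofReal (h i)
  have hpt : ∀ x, (‖truncRiesz n ν ε f x‖₊ : ℝ≥0∞) ^ 2 ≤
      ∑ i, (2 * ENNReal.ofReal (kernelOp (rieszKernel n ε i) ν f x ^ 2) +
        2 * ENNReal.ofReal (localAvg n ε ν f x ^ 2)) := fun x => by
    rw [coe_nnnorm_sq_eq_ofReal, EuclideanSpace.real_norm_sq_eq,
      ENNReal.ofReal_sum_of_nonneg fun i _ => sq_nonneg _]
    refine Finset.sum_le_sum fun i _ => ofReal_sq_le_of_abs_sub_le ?_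
    rw [abs_sub_comm]
    exact abs_kernelOp_sub_truncRiesz_le hε hf hfi i x
  refine (lintegral_mono hpt).trans ?_
  rw [lintegral_finsetSum _ fun i _ => by have := hKm i; fun_prop]
  calc _ ≤ ∑ _ : Fin d, ENNReal.ofReal (2 * (B + c ^ 2)) * ∫⁻ x, ENNReal.ofReal (f x ^ 2) ∂ν := by
        refine Finset.sum_le_sum fun i _ => ?_
        rw [lintegral_add_right _ (hGm.const_mul _),
          lintegral_const_mul _ ((hKm i).pow_const 2).ennreal_ofReal, lintegral_const_mul _ hGm]
        refine (add_le_add (mul_le_mul_right (hK i) 2) (mul_le_mul_right hG 2)).trans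
          (le_of_eq ?_)
        rw [ENNReal.ofReal_mul (by norm_num), ENNReal.ofReal_add hB (by positivity),
          ENNReal.ofReal_ofNat]
        ring
    _ = _ := by
        rw [Finset.sum_const, Finset.card_univ, Fintype.card_fin, nsmul_eq_mul, ← mul_assoc,
          ENNReal.ofReal_mul (p := (d : ℝ)) (by positivity), ENNReal.ofReal_natCast]

/-- The bound for finite measures with bounded support. -/
def sumConst (d n : ℕ) (c C : ℝ) : ℝ :=
  d * (2 * (150000 * (8 * weakConst n (1 + (n + 1) * 4 ^ n) c (2 * (C + c ^ 2))) ^ 2 +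
    (2 * c) ^ 2)) + 1

lemma lintegral_truncRiesz_add_le {μ σ : Measure (Euc d)} [IsFiniteMeasure μ] [IsFiniteMeasure σ]
    (hε : 0 < ε) (hc : 0 ≤ c) (hC : 0 ≤ C)
    (hgμ : ∀ (x : Euc d) (r : ℝ), 0 < r → μ.real (closedBall x r) ≤ c * r ^ n)
    (hgσ : ∀ (x : Euc d) (r : ℝ), 0 < r → σ.real (closedBall x r) ≤ c * r ^ n)
    (hμ : ∀ f : Euc d → ℝ, Measurable f → ∫⁻ x, (‖truncRiesz n μ ε f x‖₊ : ℝ≥0∞) ^ 2 ∂μ ≤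
      ENNReal.ofReal C * ∫⁻ x, (‖f x‖₊ : ℝ≥0∞) ^ 2 ∂μ)
    (hσ : ∀ f : Euc d → ℝ, Measurable f → ∫⁻ x, (‖truncRiesz n σ ε f x‖₊ : ℝ≥0∞) ^ 2 ∂σ ≤
      ENNReal.ofReal C * ∫⁻ x, (‖f x‖₊ : ℝ≥0∞) ^ 2 ∂σ)
    {N : ℝ} (hN : 0 < N) (hμN : μ (closedBall 0 N)ᶜ = 0) (hσN : σ (closedBall 0 N)ᶜ = 0)
    {f : Euc d → ℝ} (hf : Measurable f) (hf2 : Integrable (fun x => f x ^ 2) (μ + σ)) :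
    ∫⁻ x, (‖truncRiesz n (μ + σ) ε f x‖₊ : ℝ≥0∞) ^ 2 ∂(μ + σ) ≤
      ENNReal.ofReal (sumConst d n c C) * ∫⁻ x, (‖f x‖₊ : ℝ≥0∞) ^ 2 ∂(μ + σ) := by
  have hbdd : ∀ (ν : Measure (Euc d)) [IsFiniteMeasure ν] (u : Euc d → ℝ), Measurable u →
      (∀ y, |u y| ≤ 1) → Integrable (fun x => u x ^ 2) ν := fun ν _ u hu hu1 =>
    integrable_of_abs_le (hu.pow_const 2) (C := 1) fun x => by
      rw [abs_pow]; exact pow_le_one₀ (abs_nonneg _) (hu1 x)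
  refine (lintegral_truncRiesz_sq_le (c := 2 * c)
    (B := 150000 * (8 * weakConst n (1 + (n + 1) * 4 ^ n) c (2 * (C + c ^ 2))) ^ 2)
    hε (by positivity) (by positivity) (fun x r hr => ?_) hf hf2 fun i => ?_).trans ?_
  · rw [measureReal_add_apply]
    linarith [hgμ x r hr, hgσ x r hr]
  · exact (oddCZKernel_rieszKernel n hε i).strongTwoTwo_add hε (by positivity) hc (by positivity)
      hgμ hgσ
      (fun u hu hu1 => integral_kernelOp_sq_le_of_truncRiesz hε hc hC hgμ hu (hbdd μ u hu hu1)
        (hμ u hu) i)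
      (fun u hu hu1 => integral_kernelOp_sq_le_of_truncRiesz hε hc hC hgσ hu (hbdd σ u hu hu1)
        (hσ u hu) i) hN hμN hσN f hf hf2
  · gcongr
    rw [sumConst]
    linarith

lemma lintegral_truncRiesz_le_of_restrict {ω : Measure (Euc d)} {D : ℝ}
    (hfin : ∀ N : ℕ, IsFiniteMeasure (ω.restrict (closedBall 0 (N + 1))))
    {f : Euc d → ℝ} (hf : Measurable f)
    (h : ∀ N : ℕ, ∫⁻ x in closedBall 0 (N + 1),
      (‖truncRiesz n (ω.restrict (closedBall 0 (N + 1))) ε f x‖₊ : ℝ≥0∞) ^ 2 ∂ω ≤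
        ENNReal.ofReal D * ∫⁻ x in closedBall 0 (N + 1), (‖f x‖₊ : ℝ≥0∞) ^ 2 ∂ω) :
    ∫⁻ x, (‖truncRiesz n ω ε f x‖₊ : ℝ≥0∞) ^ 2 ∂ω ≤
      ENNReal.ofReal D * ∫⁻ x, (‖f x‖₊ : ℝ≥0∞) ^ 2 ∂ω := by
  set B : ℕ → Set (Euc d) := fun N => closedBall 0 (N + 1) with hB
  have hBm : ∀ N, MeasurableSet (B N) := fun N => measurableSet_closedBall
  have hBmono : Monotone B := fun N M hNM => closedBall_subset_closedBall (by gcongr)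
  have hBev : ∀ x, ∃ N₀, ∀ N, N₀ ≤ N → x ∈ B N := fun x => by
    obtain ⟨N₀, hN₀⟩ := exists_nat_ge ‖x‖
    refine ⟨N₀, fun N hN => ?_⟩
    have : (N₀ : ℝ) ≤ N := by exact_mod_cast hN
    simp only [hB, mem_closedBall, dist_zero_right]
    linarith
  set F : ℕ → Euc d → ℝ≥0∞ := fun N =>
    (B N).indicator fun x => (‖truncRiesz n (ω.restrict (B N)) ε f x‖₊ : ℝ≥0∞) ^ 2 with hF
  have hFm : ∀ N, Measurable (F N) := fun N => by
    have := hfin N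
    exact ((measurable_truncRiesz (ν := ω.restrict (B N)) hf).nnnorm.coe_nnreal_ennreal.pow_const
      2).indicator (hBm N)
  have hpt : ∀ x, (‖truncRiesz n ω ε f x‖₊ : ℝ≥0∞) ^ 2 ≤ liminf (fun N => F N x) atTop := by
    intro x
    by_cases hint : IntegrableOn (fun y => (‖x - y‖ ^ (n + 1))⁻¹ • f y • (x - y))
        {y | ε < ‖x - y‖} ω
    swap
    · rw [truncRiesz, integral_undef hint]
      simp
    have hU : ⋃ N, (B N ∩ {y : Euc d | ε < ‖x - y‖}) = {y : Euc d | ε < ‖x - y‖} := by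
      rw [← iUnion_inter, inter_eq_right]
      intro y _
      obtain ⟨N, hN⟩ := hBev y
      exact mem_iUnion.2 ⟨N, hN N le_rfl⟩
    have hlim : Tendsto (fun N => truncRiesz n (ω.restrict (B N)) ε f x) atTop
        (𝓝 (truncRiesz n ω ε f x)) := by
      have := tendsto_setIntegral_of_monotone (μ := ω)
        (f := fun y => (‖x - y‖ ^ (n + 1))⁻¹ • f y • (x - y))
        (s := fun N => B N ∩ {y : Euc d | ε < ‖x - y‖})
        (fun N => (hBm N).inter (measurableSet_lt_norm_sub ε x))
        (fun N M hNM => inter_subset_inter_left _ (hBmono hNM)) (by rwa [hU])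
      rw [hU] at this
      refine this.congr fun N => ?_
      rw [truncRiesz, Measure.restrict_restrict (measurableSet_lt_norm_sub ε x), inter_comm]
    have hlim2 : Tendsto (fun N => F N x) atTop (𝓝 ((‖truncRiesz n ω ε f x‖₊ : ℝ≥0∞) ^ 2)) := by
      have h1 : Tendsto (fun N => (‖truncRiesz n (ω.restrict (B N)) ε f x‖₊ : ℝ≥0∞) ^ 2) atTop
          (𝓝 ((‖truncRiesz n ω ε f x‖₊ : ℝ≥0∞) ^ 2)) :=
        ((ENNReal.continuous_pow 2).tendsto _).comp (ENNReal.tendsto_coe.2 hlim.nnnorm)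
      refine h1.congr' ?_
      obtain ⟨N₀, hN₀⟩ := hBev x
      filter_upwards [eventually_ge_atTop N₀] with N hN
      rw [hF]
      simp only [indicator_of_mem (hN₀ N hN)]
    exact hlim2.liminf_eq.ge
  calc _ ≤ ∫⁻ x, liminf (fun N => F N x) atTop ∂ω := lintegral_mono hpt
    _ ≤ liminf (fun N => ∫⁻ x, F N x ∂ω) atTop := lintegral_liminf_le hFm
    _ ≤ _ := by
      refine (liminf_le_liminf
        (v := fun _ : ℕ => ENNReal.ofReal D * ∫⁻ x, (‖f x‖₊ : ℝ≥0∞) ^ 2 ∂ω)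
        (Eventually.of_forall fun N => ?_)).trans (liminf_const _).le
      simp only [hF]
      rw [lintegral_indicator (hBm N)]
      exact (h N).trans (by gcongr; exact Measure.restrict_le_self)

lemma GrowthDeg.measure_closedBall_lt_top {μ : Measure (Euc d)} (h : GrowthDeg n μ c) {r : ℝ}
    (hr : 0 < r) : μ (closedBall 0 r) < ∞ :=
  (h 0 r hr).trans_lt ENNReal.ofReal_lt_top

lemma GrowthDeg.measureReal_restrict_le {μ : Measure (Euc d)} {c' : ℝ} (h : GrowthDeg n μ c')
    (hc : 0 ≤ c) (hc' : c' ≤ c) (B : Set (Euc d)) (x : Euc d) {r : ℝ} (hr : 0 < r) :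
    (μ.restrict B).real (closedBall x r) ≤ c * r ^ n := by
  refine ENNReal.toReal_le_of_le_ofReal (by positivity) ?_
  refine (Measure.restrict_apply_le _ _).trans ((h x r hr).trans (ENNReal.ofReal_le_ofReal ?_))
  gcongr

end Assembly

end

/-- **Proposition.** If `μ` and `σ` have growth of degree `n` and `R_μ`, `R_σ` are bounded in
`L²(μ)`, `L²(σ)` respectively, then `R_{μ+σ}` is bounded in `L²(μ+σ)`. -/
theorem riesz_bounded_sum (d n : ℕ) (μ σ : Measure (Euc d))
    (cμ cσ : ℝ) (hgμ : GrowthDeg n μ cμ) (hgσ : GrowthDeg n σ cσ)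
    (hμ : RieszBounded n μ) (hσ : RieszBounded n σ) :
    RieszBounded n (μ + σ) := by
  obtain ⟨C₁, hC₁, hμ⟩ := hμ
  obtain ⟨C₂, hC₂, hσ⟩ := hσ
  set c := |cμ| + |cσ|
  have hc : 0 ≤ c := by positivity
  have hcμ : cμ ≤ c := (le_abs_self _).trans (le_add_of_nonneg_right (abs_nonneg _))
  have hcσ : cσ ≤ c := (le_abs_self _).trans (le_add_of_nonneg_left (abs_nonneg _))
  have hC : 0 ≤ C₁ + C₂ := by positivity
  have hD : 0 < sumConst d n c (C₁ + C₂) := by unfold sumConst; positivity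
  refine ⟨sumConst d n c (C₁ + C₂), hD, fun ε hε f hf => ?_⟩
  by_cases hfin : ∫⁻ x, (‖f x‖₊ : ℝ≥0∞) ^ 2 ∂(μ + σ) = ∞
  · rw [hfin, ENNReal.mul_top (ENNReal.ofReal_pos.2 hD).ne']
    exact le_top
  have hf2 : Integrable (fun x => f x ^ 2) (μ + σ) := by
    refine ⟨(hf.pow_const 2).aestronglyMeasurable, ?_⟩
    rw [hasFiniteIntegral_iff_ofReal (ae_of_all _ fun x => sq_nonneg _)]
    simpa only [coe_nnnorm_real_sq_eq_ofReal] using lt_top_iff_ne_top.2 hfin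
  have hfinμ : ∀ N : ℕ, IsFiniteMeasure (μ.restrict (closedBall 0 ((N : ℝ) + 1))) := fun N =>
    isFiniteMeasure_restrict.2 (hgμ.measure_closedBall_lt_top (by positivity)).ne
  have hfinσ : ∀ N : ℕ, IsFiniteMeasure (σ.restrict (closedBall 0 ((N : ℝ) + 1))) := fun N =>
    isFiniteMeasure_restrict.2 (hgσ.measure_closedBall_lt_top (by positivity)).ne
  refine lintegral_truncRiesz_le_of_restrict (fun N => ?_) hf fun N => ?_
  · rw [Measure.restrict_add]
    have := hfinμ N
    have := hfinσ N
    infer_instance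
  · have := hfinμ N
    have := hfinσ N
    have hf2' := hf2.integrableOn (s := closedBall 0 ((N : ℝ) + 1))
    rw [IntegrableOn, Measure.restrict_add] at hf2'
    rw [Measure.restrict_add]
    have hnull : ∀ ν : Measure (Euc d),
        ν.restrict (closedBall 0 ((N : ℝ) + 1)) (closedBall 0 ((N : ℝ) + 1))ᶜ = 0 := fun ν => by
      rw [Measure.restrict_apply measurableSet_closedBall.compl, compl_inter_self, measure_empty]
    refine lintegral_truncRiesz_add_le hε hc hC
      (fun x r hr => hgμ.measureReal_restrict_le hc hcμ _ x hr)
      (fun x r hr => hgσ.measureReal_restrict_le hc hcσ _ x hr)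
      (fun g hg => ?_) (fun g hg => ?_) (by positivity) (hnull μ) (hnull σ) hf hf2'
    · refine (lintegral_truncRiesz_restrict_le (hμ ε hε) measurableSet_closedBall hg).trans ?_
      gcongr
      linarith
    · refine (lintegral_truncRiesz_restrict_le (hσ ε hε) measurableSet_closedBall hg).trans ?_
      gcongr
      linarith
end

section
/- Let μ be a compactly supported finite Borel measure in ℝ^d and set D = diam(supp μ). Let F = {x ∈ supp μ : θ^n_*(x,μ) > 0}, and for positive integers p, s define F_p = {x ∈ F : μ(B(x,r)) ≥ r^n/p for all 0 < r ≤ D} and F_{p,s} = {x ∈ F_p : μ(F_p ∩ B(x,r)) ≥ r^n/(ps) for all 0 < r ≤ D}. Then F = ∪_{p≥1} F_p, and for each p one has μ(F_p \ ∪_{s≥1} F_{p,s}) = 0. Consequently, if θ^n_*(x,μ) > 0 for μ-a.e. x, then μ ≤ Σ_{p,s≥1} μ⌊F_{p,s}. -/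
open MeasureTheory Metric Set Filter
open scoped ENNReal NNReal Topology

/-- A monotone function bounded below by a positive multiple of `r ^ n` near `0` is bounded below
by `r ^ n / s` on `(0, D]` for some positive integer `s`. -/
theorem exists_nat_pow_div_le {f : ℝ → ℝ≥0∞} (hf : Monotone f) {n : ℕ} {c : ℝ≥0∞} (hc : 0 < c)
    (h : ∀ᶠ r in 𝓝[>] (0 : ℝ), c * ENNReal.ofReal (r ^ n) ≤ f r) (D : ℝ) :
    ∃ s : ℕ, 1 ≤ s ∧ ∀ r : ℝ, 0 < r → r ≤ D → ENNReal.ofReal (r ^ n / (s : ℝ)) ≤ f r := by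
  obtain ⟨δ, hδ, hball⟩ := mem_nhdsGT_iff_exists_Ioc_subset.1 h
  simp only [mem_Ioi] at hδ
  obtain ⟨a, ha, hac⟩ := ENNReal.lt_iff_exists_nnreal_btwn.1 hc
  have ha : (0 : ℝ) < a := by exact_mod_cast ha
  have key : ∀ r : ℝ, 0 < r → r ≤ δ → ENNReal.ofReal (a * r ^ n) ≤ f r := by
    intro r hr hrδ
    refine le_trans ?_ (hball ⟨hr, hrδ⟩)
    rw [ENNReal.ofReal_mul ha.le, ENNReal.ofReal_coe_nnreal]
    gcongr
  obtain ⟨s₁, hs₁⟩ := exists_nat_ge (1 / (a : ℝ))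
  obtain ⟨s₂, hs₂⟩ := exists_nat_ge (D ^ n / (a * δ ^ n))
  refine ⟨s₁ + s₂ + 1, by omega, fun r hr hrD => ?_⟩
  have hδn : 0 < a * δ ^ n := by positivity
  have hs : (0 : ℝ) < ((s₁ + s₂ + 1 : ℕ) : ℝ) := by positivity
  have hs₁' : (0 : ℝ) ≤ s₁ := by positivity
  have hs₂' : (0 : ℝ) ≤ s₂ := by positivity
  rcases le_total r δ with hrδ | hrδ
  · refine le_trans (ENNReal.ofReal_le_ofReal ?_) (key r hr hrδ)
    rw [div_le_iff₀ hs, mul_right_comm]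
    have : 1 ≤ a * ((s₁ + s₂ + 1 : ℕ) : ℝ) := by
      rw [div_le_iff₀ ha] at hs₁
      push_cast
      nlinarith
    exact le_mul_of_one_le_left (by positivity) this
  · refine le_trans (ENNReal.ofReal_le_ofReal ?_) ((key δ hδ le_rfl).trans (hf hrδ))
    rw [div_le_iff₀ hs]
    rw [div_le_iff₀ hδn] at hs₂
    have : r ^ n ≤ D ^ n := by gcongr
    push_cast
    nlinarith

theorem ae_mem_measureSupport {d : ℕ} (μ : Measure (Euc d)) : ∀ᵐ x ∂μ, x ∈ measureSupport μ := by
  refine measure_null_of_locally_null _ fun x hx => ?_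
  have hx : ¬ ∀ r : ℝ, 0 < r → 0 < μ (ball x r) := hx
  push Not at hx
  obtain ⟨r, hr, h0⟩ := hx
  exact ⟨ball x r, mem_nhdsWithin_of_mem_nhds (ball_mem_nhds x hr), le_zero_iff.1 h0⟩

theorem exists_pos_mul_le_of_lowerDensity_pos {d n : ℕ} {μ : Measure (Euc d)} {x : Euc d}
    (hx : 0 < lowerDensity n μ x) :
    ∃ c : ℝ≥0∞, 0 < c ∧
      ∀ᶠ r in 𝓝[>] (0 : ℝ), c * ENNReal.ofReal (r ^ n) ≤ μ (closedBall x r) := by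
  obtain ⟨c, hc, hcx⟩ := exists_between hx
  refine ⟨c, hc, ?_⟩
  filter_upwards [eventually_lt_of_lt_liminf hcx] with r hr
  exact ENNReal.mul_le_of_le_div hr.le

/-- Almost every point of a set satisfies, within the set, the lower growth bound of the
ambient measure, up to a factor. -/
theorem ae_restrict_pos_mul_le {d n : ℕ} (μ : Measure (Euc d)) [IsFiniteMeasure μ]
    (S : Set (Euc d)) :
    ∀ᵐ x ∂μ.restrict S, ∀ c : ℝ≥0∞, 0 < c →
      (∀ᶠ r in 𝓝[>] (0 : ℝ), c * ENNReal.ofReal (r ^ n) ≤ μ (closedBall x r)) →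
      ∀ᶠ r in 𝓝[>] (0 : ℝ), c / 2 * ENNReal.ofReal (r ^ n) ≤ μ (S ∩ closedBall x r) := by
  filter_upwards [Besicovitch.ae_tendsto_measure_inter_div μ S] with x hx c hc h
  filter_upwards [h, hx.eventually (lt_mem_nhds ENNReal.one_half_lt_one)] with r hr hr2
  calc c / 2 * ENNReal.ofReal (r ^ n) = 2⁻¹ * (c * ENNReal.ofReal (r ^ n)) := by
        rw [div_eq_mul_inv]; ring
    _ ≤ 2⁻¹ * μ (closedBall x r) := by gcongr
    _ ≤ μ (S ∩ closedBall x r) := ENNReal.mul_le_of_le_div hr2.le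

/-- Decomposition of the support according to lower density: `F = ∪_{p≥1} F_p`,
`μ(F_p \ ∪_{s≥1} F_{p,s}) = 0`, and if the lower density is positive `μ`-a.e. then
`μ ≤ Σ_{p,s≥1} μ⌊F_{p,s}`. -/
theorem density_decomposition (d n : ℕ) (μ : Measure (Euc d)) [IsFiniteMeasure μ]
    (hcomp : IsCompact (measureSupport μ))
    (D : ℝ) (hD : D = Metric.diam (measureSupport μ))
    (F : Set (Euc d)) (hF : F = {x ∈ measureSupport μ | 0 < lowerDensity n μ x})
    (Fp : ℕ → Set (Euc d))
    (hFp : ∀ p : ℕ, Fp p = {x ∈ F | ∀ r : ℝ, 0 < r → r ≤ D →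
      ENNReal.ofReal (r ^ n / (p : ℝ)) ≤ μ (closedBall x r)})
    (Fps : ℕ → ℕ → Set (Euc d))
    (hFps : ∀ p s : ℕ, Fps p s = {x ∈ Fp p | ∀ r : ℝ, 0 < r → r ≤ D →
      ENNReal.ofReal (r ^ n / ((p : ℝ) * (s : ℝ))) ≤ μ (Fp p ∩ closedBall x r)}) :
    (F = ⋃ (p : ℕ) (_ : 1 ≤ p), Fp p) ∧
    (∀ p : ℕ, 1 ≤ p → μ (Fp p \ ⋃ (s : ℕ) (_ : 1 ≤ s), Fps p s) = 0) ∧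
    ((∀ᵐ x ∂μ, 0 < lowerDensity n μ x) →
      μ ≤ Measure.sum (fun ps : ℕ × ℕ => μ.restrict (Fps (ps.1 + 1) (ps.2 + 1)))) := by
  have hcover : F = ⋃ (p : ℕ) (_ : 1 ≤ p), Fp p := by
    ext x
    simp only [mem_iUnion, exists_prop]
    constructor
    · intro hx
      have hx' := hx
      rw [hF] at hx'
      obtain ⟨c, hc, h⟩ := exists_pos_mul_le_of_lowerDensity_pos hx'.2
      obtain ⟨p, hp, hb⟩ := exists_nat_pow_div_le
        (fun a b hab => measure_mono (closedBall_subset_closedBall hab)) hc h D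
      exact ⟨p, hp, by rw [hFp]; exact ⟨hx, hb⟩⟩
    · rintro ⟨p, -, hx⟩
      rw [hFp] at hx
      exact hx.1
  have hnull : ∀ p : ℕ, 1 ≤ p → μ (Fp p \ ⋃ (s : ℕ) (_ : 1 ≤ s), Fps p s) = 0 := by
    intro p hp
    have hae := ae_imp_of_ae_restrict (ae_restrict_pos_mul_le (n := n) μ (Fp p))
    refine measure_mono_null (fun x hx => ?_) (ae_iff.1 hae)
    intro hgood
    obtain ⟨hxp, hxs⟩ := hx
    apply hxs
    have hxF := hxp
    rw [hFp, hF] at hxF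
    obtain ⟨c, hc, h⟩ := exists_pos_mul_le_of_lowerDensity_pos hxF.1.2
    obtain ⟨s, hs, hb⟩ := exists_nat_pow_div_le (f := fun r => μ (Fp p ∩ closedBall x r))
      (fun a b hab => measure_mono (inter_subset_inter_right _ (closedBall_subset_closedBall hab)))
      (ENNReal.half_pos hc.ne') (hgood hxp c hc h) D
    simp only [mem_iUnion, exists_prop]
    refine ⟨s, hs, ?_⟩
    rw [hFps]
    refine ⟨hxp, fun r hr hrD => le_trans (ENNReal.ofReal_le_ofReal ?_) (hb r hr hrD)⟩
    have hp' : (1 : ℝ) ≤ p := by exact_mod_cast hp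
    have hs' : (0 : ℝ) < s := by exact_mod_cast hs
    gcongr
    exact le_mul_of_one_le_left hs'.le hp'
  refine ⟨hcover, hnull, fun hpos => Measure.le_iff.2 fun A hA => ?_⟩
  have hall : ∀ᵐ x ∂μ, ∀ p : ℕ, 1 ≤ p → x ∉ Fp p \ ⋃ (s : ℕ) (_ : 1 ≤ s), Fps p s := by
    refine ae_all_iff.2 fun p => eventually_imp_distrib_left.2 fun hp =>
      measure_eq_zero_iff_ae_notMem.1 (hnull p hp)
  have hA_le : A ≤ᵐ[μ] ⋃ ps : ℕ × ℕ, A ∩ Fps (ps.1 + 1) (ps.2 + 1) := by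
    filter_upwards [hpos, ae_mem_measureSupport μ, hall] with x hx hxs hxall hxA
    have hxF : x ∈ F := by rw [hF]; exact ⟨hxs, hx⟩
    rw [hcover] at hxF
    simp only [mem_iUnion, exists_prop] at hxF
    obtain ⟨p, hp, hxp⟩ := hxF
    have hmem : x ∈ ⋃ (s : ℕ) (_ : 1 ≤ s), Fps p s := by
      by_contra hn
      exact hxall p hp ⟨hxp, hn⟩
    simp only [mem_iUnion, exists_prop] at hmem
    obtain ⟨s, hs, hxps⟩ := hmem
    refine mem_iUnion.2 ⟨(p - 1, s - 1), hxA, ?_⟩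
    simpa only [Nat.sub_add_cancel hp, Nat.sub_add_cancel hs] using hxps
  calc μ A ≤ μ (⋃ ps : ℕ × ℕ, A ∩ Fps (ps.1 + 1) (ps.2 + 1)) := measure_mono_ae hA_le
    _ ≤ ∑' ps : ℕ × ℕ, μ (A ∩ Fps (ps.1 + 1) (ps.2 + 1)) := measure_iUnion_le _
    _ = _ := by simp only [Measure.sum_apply _ hA, Measure.restrict_apply hA]
end
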